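/- arXiv:1003.5844 — 4 statements merged into one kernel-verified Lean document; each statement's English description precedes it below -/
import Mathlib

section
/- Let α ∈ [0,1) and let w : [0,∞) → ℝ be a continuous function. Define x : [0,∞) → ℝ by x_t = w_t + (α/(1−α))·sup_{0≤s≤t} w_s. Then x is continuous and satisfies the perturbed path equation x_t = w_t + α·sup_{0≤s≤t} x_s for all t ≥ 0. -/
open Set

/-- The running maximum of a path continuous on `[0,∞)` is continuous on `[0,∞)`. -/
theorem continuousOn_sSup_image_Icc {w : ℝ → ℝ} (hw : ContinuousOn w (Set.Ici 0)) :
    ContinuousOn (fun t => sSup (w '' Set.Icc 0 t)) (Set.Ici 0) := by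
  have hW : Continuous fun s => w (max 0 s) :=
    hw.comp_continuous (by fun_prop) fun s => le_max_left 0 s
  have hsup : Continuous fun t : ℝ => sSup ((fun u : ℝ => w (max 0 (t * u))) '' Set.Icc 0 1) :=
    isCompact_Icc.continuous_sSup (hW.comp (continuous_fst.mul continuous_snd))
  refine hsup.continuousOn.congr fun t (ht : 0 ≤ t) => ?_
  have himage : Set.Icc 0 t = (fun u : ℝ => max 0 (t * u)) '' Set.Icc 0 1 := by
    have hmul : (fun u : ℝ => t * u) '' Set.Icc 0 1 = Set.Icc 0 t := by
      simp [Set.image_mul_left_Icc ht zero_le_one]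
    rw [← hmul]
    exact Set.image_congr fun u hu => (max_eq_right (mul_nonneg ht hu.1)).symm
  simp only [himage, Set.image_image]

/-- Adding to a path a nonnegative multiple `c` of its running maximum multiplies the running
maximum by `1 + c`. -/
theorem isGreatest_image_add_mul_sSup {w x : ℝ → ℝ} {c t : ℝ} (hc : 0 ≤ c) (ht : 0 ≤ t)
    (hw : ContinuousOn w (Set.Icc 0 t))
    (hx : ∀ s ∈ Set.Icc 0 t, x s = w s + c * sSup (w '' Set.Icc 0 s)) :
    IsGreatest (x '' Set.Icc 0 t) ((1 + c) * sSup (w '' Set.Icc 0 t)) := by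
  have hbdd : BddAbove (w '' Set.Icc 0 t) := isCompact_Icc.bddAbove_image hw
  have hmono : ∀ s ∈ Set.Icc 0 t, sSup (w '' Set.Icc 0 s) ≤ sSup (w '' Set.Icc 0 t) :=
    fun s hs => csSup_le_csSup hbdd ((Set.nonempty_Icc.2 hs.1).image w)
      (Set.image_mono (Set.Icc_subset_Icc_right hs.2))
  constructor
  · obtain ⟨s, hs, hmax⟩ := isCompact_Icc.exists_sSup_image_eq (Set.nonempty_Icc.2 ht) hw
    have hle : w s ≤ sSup (w '' Set.Icc 0 s) :=
      le_csSup (hbdd.mono (Set.image_mono (Set.Icc_subset_Icc_right hs.2)))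
        (Set.mem_image_of_mem w ⟨hs.1, le_rfl⟩)
    have heq : sSup (w '' Set.Icc 0 s) = sSup (w '' Set.Icc 0 t) :=
      le_antisymm (hmono s hs) (hmax ▸ hle)
    refine ⟨s, hs, ?_⟩
    rw [hx s hs, heq, hmax]
    ring
  · rintro _ ⟨s, hs, rfl⟩
    rw [hx s hs, add_mul, one_mul]
    exact add_le_add (le_csSup hbdd (Set.mem_image_of_mem w hs))
      (mul_le_mul_of_nonneg_left (hmono s hs) hc)

/-- For `α ∈ [0,1)` and a continuous path `w` on `[0,∞)`, the path
`x_t = w_t + (α/(1-α))·max_{0≤s≤t} w_s` is continuous and solves the perturbed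
path equation `x_t = w_t + α·max_{0≤s≤t} x_s` for all `t ≥ 0`. -/
theorem perturbed_path_explicit_solution
    (α : ℝ) (hα : α ∈ Set.Ico (0 : ℝ) 1)
    (w : ℝ → ℝ) (hw : ContinuousOn w (Set.Ici 0))
    (x : ℝ → ℝ)
    (hx : ∀ t : ℝ, 0 ≤ t →
      x t = w t + (α / (1 - α)) * sSup (w '' Set.Icc 0 t)) :
    ContinuousOn x (Set.Ici 0) ∧
      ∀ t : ℝ, 0 ≤ t → x t = w t + α * sSup (x '' Set.Icc 0 t) := by
  have hpos : 0 < 1 - α := sub_pos.2 hα.2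
  refine ⟨(hw.add (continuousOn_const.mul (continuousOn_sSup_image_Icc hw))).congr hx,
    fun t ht => ?_⟩
  rw [(isGreatest_image_add_mul_sSup (div_nonneg hα.1 hpos.le) ht
    (hw.mono Set.Icc_subset_Ici_self) fun s hs => hx s hs.1).csSup_eq, hx t ht]
  field_simp
  ring
end

section
/- Let α ∈ [0,1), let w : [0,∞) → ℝ be continuous, and define x_t = w_t + (α/(1−α))·sup_{0≤s≤t} w_s. Then for every t ≥ 0 the running maximum of x satisfies sup_{0≤s≤t} x_s = (1/(1−α))·sup_{0≤s≤t} w_s. -/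
open Set

/-- For `α ∈ [0,1)` and a continuous path `w` on `[0,∞)`, the running
maximum of `x_t = w_t + (α/(1-α))·max_{0≤s≤t} w_s` satisfies
`max_{0≤s≤t} x_s = (1/(1-α))·max_{0≤s≤t} w_s` for every `t ≥ 0`. -/
theorem perturbed_path_running_max
    (α : ℝ) (hα : α ∈ Set.Ico (0 : ℝ) 1)
    (w : ℝ → ℝ) (hw : ContinuousOn w (Set.Ici 0))
    (x : ℝ → ℝ)
    (hx : ∀ t : ℝ, 0 ≤ t →
      x t = w t + (α / (1 - α)) * sSup (w '' Set.Icc 0 t)) :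
    ∀ t : ℝ, 0 ≤ t →
      sSup (x '' Set.Icc 0 t) = (1 / (1 - α)) * sSup (w '' Set.Icc 0 t) := by
  intro t ht
  obtain ⟨hα0, hα1⟩ := hα
  have hpos : 0 < 1 - α := by linarith
  have hc : 0 ≤ α / (1 - α) := by positivity
  have hsum : 1 / (1 - α) = 1 + α / (1 - α) := by field_simp; ring
  obtain ⟨u, hu, hmax⟩ := isCompact_Icc.exists_isMaxOn (nonempty_Icc.2 ht)
    (hw.mono Icc_subset_Ici_self)
  have hgreatest : ∀ s, u ≤ s → s ≤ t → IsGreatest (w '' Icc 0 s) (w u) := fun s hus hst =>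
    ⟨mem_image_of_mem w ⟨hu.1, hus⟩,
      forall_mem_image.2 fun _ hr => hmax ⟨hr.1, hr.2.trans hst⟩⟩
  rw [(hgreatest t hu.2 le_rfl).csSup_eq, hsum]
  refine IsGreatest.csSup_eq ⟨⟨u, hu, ?_⟩, forall_mem_image.2 fun s hs => ?_⟩
  · rw [hx u hu.1, (hgreatest u le_rfl hu.2).csSup_eq]
    ring
  · have hsup : sSup (w '' Icc 0 s) ≤ w u :=
      csSup_le ((nonempty_Icc.2 hs.1).image w)
        (forall_mem_image.2 fun _ hr => hmax ⟨hr.1, hr.2.trans hs.2⟩)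
    rw [hx s hs.1, add_mul, one_mul]
    exact add_le_add (hmax hs) (mul_le_mul_of_nonneg_left hsup hc)
end

section
/- Let α ∈ ℝ with |α| < 1 and let y : [0,∞) → ℝ be continuous. If x and x' are two continuous functions on [0,∞) satisfying x_t = y_t + α·sup_{0≤s≤t} x_s and x'_t = y_t + α·sup_{0≤s≤t} x'_s for all t ≥ 0, then x_t = x'_t for all t ≥ 0. -/
open Set

/-- If `f ≤ g + C` on a nonempty set `s` and `g` is bounded above there, then the supremum of `f`
over `s` is at most that of `g` plus `C`. -/
theorem csSup_image_le_csSup_image_add {ι : Type*} {s : Set ι} (hs : s.Nonempty) {f g : ι → ℝ}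
    {C : ℝ} (hg : BddAbove (g '' s)) (h : ∀ i ∈ s, f i ≤ g i + C) :
    sSup (f '' s) ≤ sSup (g '' s) + C := by
  refine csSup_le (hs.image f) ?_
  rintro _ ⟨i, hi, rfl⟩
  linarith [h i hi, le_csSup hg (mem_image_of_mem g hi)]

/-- For `|α| < 1`, a continuous driver `y` on `[0,∞)` admits at most one
continuous solution of the perturbed path equation `x_t = y_t + α·max_{0≤s≤t} x_s`. -/
theorem perturbed_path_uniqueness
    (α : ℝ) (hα : |α| < 1)
    (y : ℝ → ℝ) (hy : ContinuousOn y (Set.Ici 0))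
    (x x' : ℝ → ℝ)
    (hx_cont : ContinuousOn x (Set.Ici 0))
    (hx'_cont : ContinuousOn x' (Set.Ici 0))
    (hx : ∀ t : ℝ, 0 ≤ t → x t = y t + α * sSup (x '' Set.Icc 0 t))
    (hx' : ∀ t : ℝ, 0 ≤ t → x' t = y t + α * sSup (x' '' Set.Icc 0 t)) :
    ∀ t : ℝ, 0 ≤ t → x t = x' t := by
  intro T hT
  have hcont : ContinuousOn (fun s => |x s - x' s|) (Icc 0 T) :=
    ((hx_cont.sub hx'_cont).abs).mono Icc_subset_Ici_self
  obtain ⟨t, ht, hmax⟩ := isCompact_Icc.exists_isMaxOn (nonempty_Icc.2 hT) hcont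
  have hle : ∀ s ∈ Icc 0 T, |x s - x' s| ≤ |x t - x' t| := fun s hs => hmax hs
  have hbdd {z : ℝ → ℝ} (hz : ContinuousOn z (Ici 0)) : BddAbove (z '' Icc 0 t) :=
    isCompact_Icc.bddAbove_image (hz.mono Icc_subset_Ici_self)
  have hsub : Icc 0 t ⊆ Icc 0 T := Icc_subset_Icc_right ht.2
  have hne : (Icc 0 t).Nonempty := nonempty_Icc.2 ht.1
  have hsup : |sSup (x '' Icc 0 t) - sSup (x' '' Icc 0 t)| ≤ |x t - x' t| := by
    have h₁ := csSup_image_le_csSup_image_add (f := x) (C := |x t - x' t|) hne (hbdd hx'_cont)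
      fun s hs => by
        linarith [(abs_le.1 (hle s (hsub hs))).2]
    have h₂ := csSup_image_le_csSup_image_add (f := x') (C := |x t - x' t|) hne (hbdd hx_cont)
      fun s hs => by
        linarith [(abs_le.1 (hle s (hsub hs))).1]
    exact abs_le.2 ⟨by linarith, by linarith⟩
  have hcontr : |x t - x' t| ≤ |α| * |x t - x' t| := calc
    |x t - x' t| = |α| * |sSup (x '' Icc 0 t) - sSup (x' '' Icc 0 t)| := by
      rw [← abs_mul, hx t ht.1, hx' t ht.1]
      ring_nf
    _ ≤ |α| * |x t - x' t| := by gcongr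
  have hzero : |x t - x' t| ≤ 0 := by nlinarith [abs_nonneg (x t - x' t)]
  have hT0 := (hle T (right_mem_Icc.2 hT)).trans hzero
  exact sub_eq_zero.1 (abs_nonpos_iff.1 hT0)
end

section
/- Let (Ω, F, (F_t)_{t≥0}, P) be a filtered probability space carrying a standard one-dimensional Brownian motion W, let x ∈ ℝ, and let b : ℝ × ℝ → ℝ be a bounded measurable function such that for each fixed first argument x' ∈ ℝ, the map y ↦ b(x',y) is strictly increasing on the set {y ∈ ℝ : y ≥ x'}. Then there exists a continuous process X, adapted to the (augmented) natural filtration of W, such that almost surely X_t = x + W_t + ∫_0^t b(X_s, sup_{0≤u≤s} X_u) ds for all t ≥ 0. -/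
open Set MeasureTheory ProbabilityTheory

/-- A standard one-dimensional Brownian motion `W` on a filtered probability space:
continuous paths, `W 0 = 0`, adapted, and for `0 ≤ s ≤ t` the increment `W t - W s`
is independent of `ℱ s` and has Gaussian law `N(0, t - s)`. -/
def IsStandardBrownianMotion {Ω : Type*} {m : MeasurableSpace Ω}
    (P : Measure Ω) (ℱ : Filtration ℝ m) (W : ℝ → Ω → ℝ) : Prop :=
  (∀ ω, Continuous fun t => W t ω) ∧
  (∀ ω, W 0 ω = 0) ∧
  Adapted ℱ W ∧
  (∀ s t : ℝ, 0 ≤ s → s ≤ t →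
    Indep (MeasurableSpace.comap (fun ω => W t ω - W s ω) Real.measurableSpace)
      (ℱ s) P) ∧
  (∀ s t : ℝ, 0 ≤ s → s ≤ t →
    P.map (fun ω => W t ω - W s ω) = gaussianReal 0 (Real.toNNReal (t - s)))

/-- The σ-algebra generated by a process `W` up to time `t`. -/
def naturalSigma {Ω : Type*} (W : ℝ → Ω → ℝ) (t : ℝ) : MeasurableSpace Ω :=
  ⨆ s ∈ Set.Iic t, MeasurableSpace.comap (W s) Real.measurableSpace

section

open Filter Topology
open scoped NNReal ENNReal

/-- The maximum of `f` over the interval between `0` and `s`. -/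
noncomputable def runMax (f : ℝ → ℝ) (s : ℝ) : ℝ := sSup ((fun r => f (r * s)) '' Icc 0 1)

lemma continuous_runMax {f : ℝ → ℝ} (hf : Continuous f) : Continuous (runMax f) :=
  isCompact_Icc.continuous_sSup (f := fun s r => f (r * s))
    (hf.comp (continuous_snd.mul continuous_fst))

lemma bddAbove_runMax {f : ℝ → ℝ} (hf : Continuous f) (s : ℝ) :
    BddAbove ((fun r => f (r * s)) '' Icc 0 1) :=
  (isCompact_Icc.image (hf.comp (continuous_id.mul continuous_const))).bddAbove

lemma le_runMax {f : ℝ → ℝ} (hf : Continuous f) {r s : ℝ} (hr : r ∈ Icc (0 : ℝ) 1) :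
    f (r * s) ≤ runMax f s :=
  le_csSup (bddAbove_runMax hf s) ⟨r, hr, rfl⟩

lemma self_le_runMax {f : ℝ → ℝ} (hf : Continuous f) (s : ℝ) : f s ≤ runMax f s := by
  simpa using le_runMax hf (s := s) (r := 1) (by simp)

lemma runMax_le {f : ℝ → ℝ} {s a : ℝ} (h : ∀ r ∈ Icc (0 : ℝ) 1, f (r * s) ≤ a) :
    runMax f s ≤ a :=
  csSup_le (by simp) (by rintro _ ⟨r, hr, rfl⟩; exact h r hr)

lemma runMax_eq {f : ℝ → ℝ} {s : ℝ} (hs : 0 ≤ s) :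
    runMax f s = sSup (f '' Icc 0 s) := by
  unfold runMax
  congr 1
  have : Icc 0 s = (fun r => r * s) '' Icc (0 : ℝ) 1 := by
    rw [image_mul_right_Icc (by norm_num) hs]; simp
  rw [this, image_image]

lemma exists_eq_runMax {f : ℝ → ℝ} (hf : Continuous f) (s : ℝ) :
    ∃ r ∈ Icc (0 : ℝ) 1, runMax f s = f (r * s) :=
  isCompact_Icc.exists_sSup_image_eq (by simp)
    (hf.comp (continuous_id.mul continuous_const)).continuousOn

lemma runMax_mono {f g : ℝ → ℝ} (hg : Continuous g) (h : ∀ t, f t ≤ g t) (s : ℝ) :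
    runMax f s ≤ runMax g s :=
  runMax_le fun _ hr => (h _).trans (le_runMax hg hr)

/-- Running maxima are continuous along pointwise convergence of equi-Lipschitz perturbations. -/
lemma tendsto_runMax_of_lipschitz {C : ℝ≥0} {c u : ℝ → ℝ} {v : ℕ → ℝ → ℝ} (hc : Continuous c)
    (hv : ∀ j, LipschitzWith C (v j)) (hu : LipschitzWith C u)
    (h : ∀ t, Tendsto (fun j => v j t) atTop (𝓝 (u t))) (s : ℝ) :
    Tendsto (fun j => runMax (fun t => c t + v j t) s) atTop
      (𝓝 (runMax (fun t => c t + u t) s)) := by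
  have hcv : ∀ j, Continuous fun t => c t + v j t := fun j => hc.add (hv j).continuous
  have hcu : Continuous fun t => c t + u t := hc.add hu.continuous
  have hunif : ∀ ε > 0, ∀ᶠ j in atTop, ∀ r ∈ Icc (0 : ℝ) 1, |v j (r * s) - u (r * s)| < ε := by
    intro ε hε
    have hK : IsCompact ((fun r => r * s) '' Icc (0 : ℝ) 1) :=
      isCompact_Icc.image (continuous_id.mul continuous_const)
    set δ : ℝ := ε / (4 * (C + 1)) with hδ
    have hC : (0 : ℝ) ≤ C := C.2
    have hδ0 : 0 < δ := by positivity
    have hCδ : C * δ ≤ ε / 4 := by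
      rw [hδ, mul_div_assoc', div_le_div_iff₀ (by positivity) (by positivity)]
      nlinarith
    obtain ⟨T, -, hTfin, hT⟩ := hK.finite_cover_balls hδ0
    have hev : ∀ᶠ j in atTop, ∀ p ∈ T, |v j p - u p| < ε / 4 :=
      (eventually_all_finite hTfin).2 fun p _ => by
        simpa [Real.dist_eq] using Metric.tendsto_nhds.1 (h p) (ε / 4) (by positivity)
    filter_upwards [hev] with j hj r hr
    obtain ⟨p, hpT, hp⟩ := mem_iUnion₂.1 (hT ⟨r, hr, rfl⟩)
    have h1 := (hv j).dist_le_mul (r * s) p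
    have h2 := hu.dist_le_mul (r * s) p
    have h3 := abs_lt.1 (hj p hpT)
    have h4 : C * dist (r * s) p ≤ C * δ := mul_le_mul_of_nonneg_left (le_of_lt hp) hC
    have h5 := abs_le.1 ((Real.dist_eq _ _).symm.le.trans h1)
    have h6 := abs_le.1 ((Real.dist_eq _ _).symm.le.trans h2)
    rw [abs_lt]
    constructor <;> linarith [h3.1, h3.2, h5.1, h5.2, h6.1, h6.2]
  rw [Metric.tendsto_atTop]
  intro ε hε
  obtain ⟨N, hN⟩ := eventually_atTop.1 (hunif (ε / 2) (by positivity))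
  refine ⟨N, fun j hj => ?_⟩
  have h1 : runMax (fun t => c t + v j t) s ≤ runMax (fun t => c t + u t) s + ε / 2 :=
    runMax_le fun r hr => by
      have := le_runMax hcu (s := s) hr
      have := (abs_lt.1 (hN j hj r hr)).2
      linarith
  have h2 : runMax (fun t => c t + u t) s ≤ runMax (fun t => c t + v j t) s + ε / 2 :=
    runMax_le fun r hr => by
      have := le_runMax (hcv j) (s := s) hr
      have := (abs_lt.1 (hN j hj r hr)).1
      linarith
  rw [Real.dist_eq, abs_lt]
  constructor <;> linarith

/-- Discrete maxima along regular grids converge to the running maximum, even when the sampled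
values carry an error that vanishes uniformly. -/
lemma tendsto_partialSups_grid {f : ℝ → ℝ} (hf : Continuous f) {s : ℝ} {y : ℕ → ℕ → ℝ}
    {e : ℕ → ℝ} (he : Tendsto e atTop (𝓝 0))
    (hy : ∀ N i, i ≤ N → |y N i - f (i / N * s)| ≤ e N) :
    Tendsto (fun N => partialSups (y N) N) atTop (𝓝 (runMax f s)) := by
  obtain ⟨r, hr, hrs⟩ := exists_eq_runMax hf s
  have hfl : Tendsto (fun N : ℕ => (⌊r * N⌋₊ : ℝ) / N) atTop (𝓝 r) :=
    (tendsto_nat_floor_mul_div_atTop hr.1).comp tendsto_natCast_atTop_atTop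
  have hlow : Tendsto (fun N : ℕ => f ((⌊r * N⌋₊ : ℝ) / N * s) - e N) atTop
      (𝓝 (runMax f s)) := by
    have := ((hf.tendsto (r * s)).comp (hfl.mul_const s)).sub he
    simpa [hrs] using this
  have hup : Tendsto (fun N : ℕ => runMax f s + e N) atTop (𝓝 (runMax f s)) := by
    simpa using he.const_add (runMax f s)
  refine tendsto_of_tendsto_of_tendsto_of_le_of_le hlow hup (fun N => ?_) (fun N => ?_)
  · have hle : ⌊r * N⌋₊ ≤ N := by
      apply Nat.floor_le_of_le
      nlinarith [hr.2, (Nat.cast_nonneg N : (0 : ℝ) ≤ N)]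
    have h1 := (abs_le.1 (hy N _ hle)).1
    have h2 : y N ⌊r * N⌋₊ ≤ partialSups (y N) N := le_partialSups_of_le _ hle
    dsimp only
    linarith
  · refine partialSups_le _ _ _ fun i hi => ?_
    have h1 := (abs_le.1 (hy N i hi)).2
    have h2 := le_runMax hf (s := s) (r := i / N)
      ⟨by positivity, div_le_one_of_le₀ (by exact_mod_cast hi) (by positivity)⟩
    linarith

lemma lintegral_gaussianReal_add_sq_le {v : ℝ≥0} (hv : v ≠ 0) {a C : ℝ} (ha : |a| ≤ C * v)
    {g : ℝ → ℝ≥0∞} (hg : Measurable g) :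
    (∫⁻ z, g (z + a) ∂gaussianReal 0 v) ^ 2 ≤
      ENNReal.ofReal (Real.exp (C ^ 2 * v)) * ∫⁻ z, g z ^ 2 ∂gaussianReal 0 v := by
  have hv' : (0 : ℝ) < v := by exact_mod_cast pos_iff_ne_zero.2 hv
  set d : ℝ → ℝ≥0∞ := fun z => ENNReal.ofReal (Real.exp (a / v * z - a ^ 2 / (2 * v))) with hd
  have hdm : Measurable d := by fun_prop
  have hpdf : ∀ z, gaussianPDF a v z = gaussianPDF 0 v z * d z := by
    intro z
    simp only [gaussianPDF, hd, gaussianPDFReal]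
    rw [← ENNReal.ofReal_mul (by positivity), mul_assoc _ (Real.exp _), ← Real.exp_add]
    congr 3
    field_simp
    ring
  have h1 : ∫⁻ z, g (z + a) ∂gaussianReal 0 v = ∫⁻ z, d z * g z ∂gaussianReal 0 v := by
    have : gaussianReal a v = (gaussianReal 0 v).map (· + a) := by
      rw [gaussianReal_map_add_const, zero_add]
    rw [← lintegral_map (f := g) (g := fun z => z + a) hg (by fun_prop), ← this,
      gaussianReal_of_var_ne_zero _ hv, gaussianReal_of_var_ne_zero _ hv,
      lintegral_withDensity_eq_lintegral_mul _ (measurable_gaussianPDF _ _) hg,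
      lintegral_withDensity_eq_lintegral_mul (f := gaussianPDF 0 v) _
        (measurable_gaussianPDF _ _) (g := fun z => d z * g z) (hdm.mul hg)]
    refine lintegral_congr fun z => ?_
    simp only [Pi.mul_apply, hpdf]
    ring
  have h2 : ∫⁻ z, d z ^ 2 ∂gaussianReal 0 v ≤ ENNReal.ofReal (Real.exp (C ^ 2 * v)) := by
    have : ∀ z, d z ^ 2 = ENNReal.ofReal (Real.exp (-(a ^ 2 / v))) *
        ENNReal.ofReal (Real.exp (2 * a / v * z)) := by
      intro z
      simp only [hd]
      rw [← ENNReal.ofReal_pow (by positivity), ← ENNReal.ofReal_mul (by positivity),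
        ← Real.exp_add, ← Real.exp_nat_mul]
      congr 2
      push_cast
      field_simp
      ring
    simp_rw [this]
    rw [lintegral_const_mul _ (by fun_prop),
      ← ofReal_integral_eq_lintegral_ofReal (integrable_exp_mul_gaussianReal _)
        (ae_of_all _ fun z => by positivity)]
    have hm : ∫ z, Real.exp (2 * a / v * z) ∂gaussianReal 0 v
        = Real.exp (0 * (2 * a / v) + v * (2 * a / v) ^ 2 / 2) := by
      have := congrFun (mgf_id_gaussianReal (μ := 0) (v := v)) (2 * a / v)
      simpa [mgf] using this
    rw [hm, ← ENNReal.ofReal_mul (by positivity), ← Real.exp_add]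
    apply ENNReal.ofReal_le_ofReal
    apply Real.exp_le_exp.2
    have h3 : -(a ^ 2 / v) + (0 * (2 * a / v) + v * (2 * a / v) ^ 2 / 2) = a ^ 2 / v := by
      field_simp
      ring
    rw [h3, div_le_iff₀ hv']
    have := sq_le_sq' (abs_le.1 ha).1 (abs_le.1 ha).2
    nlinarith
  rw [h1]
  have h3 := ENNReal.lintegral_mul_le_Lp_mul_Lq (gaussianReal 0 v) Real.HolderConjugate.two_two
    hdm.aemeasurable hg.aemeasurable
  have h4 : ∀ t : ℝ≥0∞, (t ^ (1 / (2 : ℝ))) ^ 2 = t := by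
    intro t
    rw [← ENNReal.rpow_natCast, ← ENNReal.rpow_mul]
    norm_num
  calc (∫⁻ z, d z * g z ∂gaussianReal 0 v) ^ 2
      ≤ ((∫⁻ z, d z ^ (2 : ℝ) ∂gaussianReal 0 v) ^ (1 / (2 : ℝ)) *
        (∫⁻ z, g z ^ (2 : ℝ) ∂gaussianReal 0 v) ^ (1 / (2 : ℝ))) ^ 2 := by
        gcongr
        exact h3
    _ = (∫⁻ z, d z ^ 2 ∂gaussianReal 0 v) * ∫⁻ z, g z ^ 2 ∂gaussianReal 0 v := by
        rw [mul_pow, h4, h4]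
        simp
    _ ≤ _ := by gcongr

lemma lintegral_comp_indep {Ω E : Type*} {m : MeasurableSpace Ω} [MeasurableSpace E]
    {P : Measure Ω} [IsProbabilityMeasure P] {Y : Ω → E} {ξ : Ω → ℝ} {γ : Measure ℝ}
    [IsProbabilityMeasure γ]
    (hY : Measurable Y) (hξ : Measurable ξ) (hind : IndepFun Y ξ P) (hlaw : P.map ξ = γ)
    {g : E → ℝ → ℝ≥0∞} (hg : Measurable (Function.uncurry g)) :
    ∫⁻ ω, g (Y ω) (ξ ω) ∂P = ∫⁻ ω, ∫⁻ z, g (Y ω) z ∂γ ∂P := by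
  have h := (indepFun_iff_map_prod_eq_prod_map_map hY.aemeasurable hξ.aemeasurable).1 hind
  have : IsProbabilityMeasure (P.map Y) := Measure.isProbabilityMeasure_map hY.aemeasurable
  calc ∫⁻ ω, g (Y ω) (ξ ω) ∂P
      = ∫⁻ p, Function.uncurry g p ∂(P.map fun ω => (Y ω, ξ ω)) := by
        rw [lintegral_map hg (hY.prodMk hξ)]; rfl
    _ = ∫⁻ y, ∫⁻ z, g y z ∂γ ∂(P.map Y) := by
        rw [h, hlaw, lintegral_prod _ hg.aemeasurable]; rfl
    _ = _ := by
        rw [lintegral_map (f := fun y => ∫⁻ z, g y z ∂γ) hg.lintegral_prod_right' hY]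

/-- A discrete Girsanov estimate: shifting Gaussian increments by bounded predictable drifts
distorts the law of the walk and its maximum in a quantitatively absolutely continuous way. -/
lemma discrete_girsanov {Ω : Type*} {m : MeasurableSpace Ω} {P : Measure Ω}
    [IsProbabilityMeasure P] {𝓕 : ℕ → MeasurableSpace Ω} (h𝓕 : Monotone 𝓕) (h𝓕m : ∀ i, 𝓕 i ≤ m)
    {v : ℝ≥0} (hv : v ≠ 0) {C : ℝ} {S R ξ a : ℕ → Ω → ℝ}
    (hξm : ∀ i, Measurable[𝓕 (i + 1)] (ξ i))
    (hξi : ∀ i, Indep (MeasurableSpace.comap (ξ i) Real.measurableSpace) (𝓕 i) P)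
    (hξl : ∀ i, P.map (ξ i) = gaussianReal 0 v)
    (ham : ∀ i, Measurable[𝓕 i] (a i)) (hab : ∀ i ω, |a i ω| ≤ C * v)
    {x : ℝ} (hS0 : ∀ ω, S 0 ω = x) (hR0 : ∀ ω, R 0 ω = x)
    (hS : ∀ i ω, S (i + 1) ω = S i ω + ξ i ω + a i ω)
    (hR : ∀ i ω, R (i + 1) ω = R i ω + ξ i ω) (n : ℕ)
    {g : ℝ × ℝ → ℝ≥0∞} (hg : Measurable g) :
    (∫⁻ ω, g (S n ω, partialSups (fun i => S i ω) n) ∂P) ^ 2 ≤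
      ENNReal.ofReal (Real.exp (C ^ 2 * v)) ^ n *
        ∫⁻ ω, g (R n ω, partialSups (fun i => R i ω) n) ^ 2 ∂P := by
  have hSm : ∀ i, Measurable[𝓕 i] (S i) := by
    intro i
    induction i with
    | zero => rw [show S 0 = fun _ => x from funext hS0]; exact measurable_const
    | succ i ih =>
      rw [show S (i + 1) = fun ω => S i ω + ξ i ω + a i ω from funext (hS i)]
      exact (((ih.mono (h𝓕 i.le_succ) le_rfl).add (hξm i)).add
        ((ham i).mono (h𝓕 i.le_succ) le_rfl))
  have hRm : ∀ i, Measurable[𝓕 i] (R i) := by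
    intro i
    induction i with
    | zero => rw [show R 0 = fun _ => x from funext hR0]; exact measurable_const
    | succ i ih =>
      rw [show R (i + 1) = fun ω => R i ω + ξ i ω from funext (hR i)]
      exact (ih.mono (h𝓕 i.le_succ) le_rfl).add (hξm i)
  have hsup : ∀ Q : ℕ → Ω → ℝ, (∀ i, Measurable[𝓕 i] (Q i)) →
      ∀ i, Measurable[𝓕 i] fun ω => partialSups (fun i => Q i ω) i := by
    intro Q hQ i
    induction i with
    | zero => simpa using hQ 0
    | succ i ih =>
      simp only [← Order.succ_eq_add_one, partialSups_succ]
      exact (ih.mono (h𝓕 i.le_succ) le_rfl).sup (hQ (i + 1))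
  induction n generalizing g with
  | zero =>
    simp [hS0, hR0]
  | succ n ih =>
    set e : ℝ≥0∞ := ENNReal.ofReal (Real.exp (C ^ 2 * v)) with he
    set γ := gaussianReal 0 v with hγ
    set G : ℝ × ℝ → ℝ≥0∞ := fun p =>
      (e * ∫⁻ z, g (p.1 + z, p.2 ⊔ (p.1 + z)) ^ 2 ∂γ) ^ (1 / (2 : ℝ)) with hG
    have hGin : Measurable fun p : ℝ × ℝ => ∫⁻ z, g (p.1 + z, p.2 ⊔ (p.1 + z)) ^ 2 ∂γ := by
      apply Measurable.lintegral_prod_right'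
        (f := fun q : (ℝ × ℝ) × ℝ => g (q.1.1 + q.2, q.1.2 ⊔ (q.1.1 + q.2)) ^ 2)
      fun_prop
    have hGm : Measurable G := (hGin.const_mul e).pow_const _
    have hGsq : ∀ p, G p ^ 2 = e * ∫⁻ z, g (p.1 + z, p.2 ⊔ (p.1 + z)) ^ 2 ∂γ := by
      intro p
      simp only [hG]
      rw [← ENNReal.rpow_natCast, ← ENNReal.rpow_mul]
      norm_num
    have hξm' : Measurable (ξ n) := (hξm n).mono (h𝓕m _) le_rfl
    have hindep : ∀ {E : Type} [MeasurableSpace E] (Y : Ω → E), Measurable[𝓕 n] Y →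
        IndepFun Y (ξ n) P := fun Y hY =>
      (indep_of_indep_of_le_right (hξi n) hY.comap_le).symm
    have h1 : ∫⁻ ω, g (S (n + 1) ω, partialSups (fun i => S i ω) (n + 1)) ∂P ≤
        ∫⁻ ω, G (S n ω, partialSups (fun i => S i ω) n) ∂P := by
      have hY : Measurable[𝓕 n] fun ω => ((S n ω, partialSups (fun i => S i ω) n), a n ω) :=
        ((hSm n).prodMk (hsup S hSm n)).prodMk (ham n)
      have := lintegral_comp_indep (hY.mono (h𝓕m n) le_rfl) hξm' (hindep _ hY) (hξl n)
        (g := fun q z => g (q.1.1 + z + q.2, q.1.2 ⊔ (q.1.1 + z + q.2))) (by fun_prop)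
      simp only [← Order.succ_eq_add_one, partialSups_succ] at this ⊢
      simp only [Order.succ_eq_add_one, hS]
      rw [this]
      refine lintegral_mono fun ω => ?_
      have h2 := lintegral_gaussianReal_add_sq_le hv (hab n ω)
        (g := fun z => g (S n ω + z, partialSups (fun i => S i ω) n ⊔ (S n ω + z))) (by fun_prop)
      simp only [← add_assoc] at h2
      rw [← hGsq (S n ω, partialSups (fun i => S i ω) n)] at h2
      exact (ENNReal.pow_le_pow_left_iff two_ne_zero).1 h2
    have h2 : ∫⁻ ω, g (R (n + 1) ω, partialSups (fun i => R i ω) (n + 1)) ^ 2 ∂P =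
        ∫⁻ ω, ∫⁻ z, g (R n ω + z, partialSups (fun i => R i ω) n ⊔ (R n ω + z)) ^ 2 ∂γ ∂P := by
      have hY : Measurable[𝓕 n] fun ω => (R n ω, partialSups (fun i => R i ω) n) :=
        (hRm n).prodMk (hsup R hRm n)
      have := lintegral_comp_indep (hY.mono (h𝓕m n) le_rfl) hξm' (hindep _ hY) (hξl n)
        (g := fun q z => g (q.1 + z, q.2 ⊔ (q.1 + z)) ^ 2) (by fun_prop)
      simp only [← Order.succ_eq_add_one, partialSups_succ] at this ⊢
      simp only [Order.succ_eq_add_one, hR]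
      rw [this]
    calc (∫⁻ ω, g (S (n + 1) ω, partialSups (fun i => S i ω) (n + 1)) ∂P) ^ 2
        ≤ (∫⁻ ω, G (S n ω, partialSups (fun i => S i ω) n) ∂P) ^ 2 := by gcongr
      _ ≤ e ^ n * ∫⁻ ω, G (R n ω, partialSups (fun i => R i ω) n) ^ 2 ∂P := ih hGm
      _ = e ^ (n + 1) *
          ∫⁻ ω, g (R (n + 1) ω, partialSups (fun i => R i ω) (n + 1)) ^ 2 ∂P := by
        simp only [hGsq]
        have hm : Measurable fun ω =>
            ∫⁻ z, g (R n ω + z, partialSups (fun i => R i ω) n ⊔ (R n ω + z)) ^ 2 ∂γ :=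
          hGin.comp (((hRm n).prodMk (hsup R hRm n)).mono (h𝓕m n) le_rfl)
        rw [lintegral_const_mul _ hm, h2, pow_succ, mul_assoc]

/-- The pair consisting of a process and its running maximum. -/
noncomputable def withMax {Ω : Type*} (X : ℝ → Ω → ℝ) (t : ℝ) (ω : Ω) : ℝ × ℝ :=
  (X t ω, runMax (fun s => X s ω) t)

/-- Adapted processes started from `0` at time `0` with `C`-Lipschitz paths. -/
structure IsDrift {Ω : Type*} (C : ℝ≥0) (𝒢 : ℝ → MeasurableSpace Ω) (u : ℝ → Ω → ℝ) : Prop where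
  lip : ∀ ω, LipschitzWith C fun t => u t ω
  zero : ∀ t ≤ 0, ∀ ω, u t ω = 0
  meas : ∀ t, Measurable[𝒢 t] (u t)

lemma IsDrift.mono {Ω : Type*} {C : ℝ≥0} {𝒢 𝒢' : ℝ → MeasurableSpace Ω} {u : ℝ → Ω → ℝ}
    (hu : IsDrift C 𝒢 u) (h : ∀ t, 𝒢 t ≤ 𝒢' t) : IsDrift C 𝒢' u :=
  ⟨hu.lip, hu.zero, fun t => (hu.meas t).mono (h t) le_rfl⟩

lemma isDrift_zero {Ω : Type*} (C : ℝ≥0) (𝒢 : ℝ → MeasurableSpace Ω) :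
    IsDrift C 𝒢 (fun _ _ => 0) :=
  ⟨fun _ => LipschitzWith.const' 0, fun _ _ _ => rfl, fun _ => measurable_const⟩

lemma IsDrift.abs_le {Ω : Type*} {C : ℝ≥0} {𝒢 : ℝ → MeasurableSpace Ω} {u : ℝ → Ω → ℝ}
    (hu : IsDrift C 𝒢 u) (t : ℝ) (ω : Ω) : |u t ω| ≤ C * |t| := by
  have := (hu.lip ω).dist_le_mul t 0
  simpa [Real.dist_eq, hu.zero 0 le_rfl] using this

/-- Running maxima of continuous processes are adapted. -/
lemma measurable_withMax {Ω : Type*} {𝒢 : ℝ → MeasurableSpace Ω} (h𝒢 : Monotone 𝒢)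
    {X : ℝ → Ω → ℝ} (hc : ∀ ω, Continuous fun t => X t ω) (hX : ∀ t, Measurable[𝒢 t] (X t))
    {t : ℝ} (ht : 0 ≤ t) : Measurable[𝒢 t] (withMax X t) := by
  refine (hX t).prodMk ?_
  have hlim : ∀ ω, Tendsto (fun N : ℕ => partialSups (fun i : ℕ => X (i / N * t) ω) N) atTop
      (𝓝 (runMax (fun s => X s ω) t)) := fun ω =>
    tendsto_partialSups_grid (hc ω) (y := fun N i => X (i / N * t) ω) (e := fun _ => 0)
      tendsto_const_nhds (by simp)
  let _ : MeasurableSpace Ω := 𝒢 t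
  refine measurable_of_tendsto_metrizable (fun N => ?_) (tendsto_pi_nhds.2 hlim)
  have hle : ∀ i ≤ N, (i / N * t : ℝ) ≤ t := fun i hi =>
    mul_le_of_le_one_left ht (div_le_one_of_le₀ (by exact_mod_cast hi) (by positivity))
  have : ∀ k ≤ N, Measurable[𝒢 t] fun ω => partialSups (fun i : ℕ => X (i / N * t) ω) k := by
    intro k
    induction k with
    | zero => intro hk; simpa using (hX _).mono (h𝒢 (hle 0 hk)) le_rfl
    | succ k ih =>
      intro hk
      simp only [← Order.succ_eq_add_one, partialSups_succ]
      exact (ih (by omega)).sup ((hX _).mono (h𝒢 (hle _ hk)) le_rfl)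
  exact this N le_rfl

section Girsanov

variable {Ω : Type*} {m : MeasurableSpace Ω} {P : Measure Ω} [IsProbabilityMeasure P]
  {ℱ : Filtration ℝ m} {W : ℝ → Ω → ℝ} {C : ℝ≥0} {u : ℝ → Ω → ℝ}

lemma sq_lintegral_withMax_le (hW : IsStandardBrownianMotion P ℱ W) (x : ℝ)
    (hu : IsDrift C ℱ u) {t : ℝ} (ht : 0 < t) (f : BoundedContinuousFunction (ℝ × ℝ) ℝ≥0) :
    (∫⁻ ω, f (withMax (fun s ω => x + W s ω + u s ω) t ω) ∂P) ^ 2 ≤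
      ENNReal.ofReal (Real.exp (C ^ 2 * t)) *
        ∫⁻ ω, (f (withMax (fun s ω => x + W s ω) t ω) : ℝ≥0∞) ^ 2 ∂P := by
  obtain ⟨hWc, hW0, hWa, hWi, hWl⟩ := hW
  have hWm : ∀ s, Measurable[ℱ s] (W s) := hWa
  have hWm' : ∀ s, Measurable (W s) := fun s => (hWm s).mono (ℱ.le s) le_rfl
  have hum' : ∀ s, Measurable (u s) := fun s => (hu.meas s).mono (ℱ.le s) le_rfl
  set S : ℕ → ℕ → Ω → ℝ := fun N i ω => x + W (i / N * t) ω + u ((i - 1) / N * t) ω with hS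
  set R : ℕ → ℕ → Ω → ℝ := fun N i ω => x + W (i / N * t) ω with hR
  have key : ∀ N : ℕ, N ≠ 0 → (∫⁻ ω, f (S N N ω, partialSups (fun i => S N i ω) N) ∂P) ^ 2 ≤
      ENNReal.ofReal (Real.exp (C ^ 2 * t)) *
        ∫⁻ ω, (f (R N N ω, partialSups (fun i => R N i ω) N) : ℝ≥0∞) ^ 2 ∂P := by
    intro N hN
    have hN0 : (0 : ℝ) < N := by exact_mod_cast Nat.pos_of_ne_zero hN
    set v : ℝ≥0 := Real.toNNReal (t / N) with hv
    have hvc : (v : ℝ) = t / N := Real.coe_toNNReal _ (by positivity)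
    have hgrid : ∀ i : ℕ, (i / N * t : ℝ) ≤ (i + 1 : ℕ) / N * t := fun i => by
      push_cast; gcongr; linarith
    have h := discrete_girsanov (P := P) (𝓕 := fun i : ℕ => ℱ (i / N * t)) (v := v) (C := C) (x := x)
      (S := S N) (R := R N) (ξ := fun i ω => W ((i + 1 : ℕ) / N * t) ω - W (i / N * t) ω)
      (a := fun i ω => u (i / N * t) ω - u ((i - 1) / N * t) ω)
      (fun i j hij => ℱ.mono (by gcongr)) (fun i => ℱ.le _)
      (by rw [hv, Ne, Real.toNNReal_eq_zero, not_le]; positivity)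
      (fun i => (hWm _).sub ((hWm _).mono (ℱ.mono (hgrid i)) le_rfl))
      (fun i => hWi _ _ (by positivity) (hgrid i))
      (fun i => by
        rw [hWl _ _ (by positivity) (hgrid i), hv]
        congr 2
        push_cast
        ring)
      (fun i => (hu.meas _).sub ((hu.meas _).mono (ℱ.mono (by gcongr; linarith)) le_rfl))
      (fun i ω => by
        have := (hu.lip ω).dist_le_mul (i / N * t) ((i - 1) / N * t)
        rw [Real.dist_eq, Real.dist_eq] at this
        refine this.trans_eq ?_
        rw [hvc, show (i / N * t - (i - 1) / N * t : ℝ) = t / N by ring,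
          abs_of_pos (by positivity)])
      (fun ω => by
        have : u ((0 - 1) / N * t) ω = 0 := hu.zero _ (by
          rw [div_mul_eq_mul_div]
          exact div_nonpos_of_nonpos_of_nonneg (by linarith) hN0.le) ω
        simp only [hS, Nat.cast_zero, this]
        simp [hW0])
      (fun ω => by simp [hR, hW0])
      (fun i ω => by simp only [hS]; push_cast; ring_nf)
      (fun i ω => by simp only [hR]; push_cast; ring_nf) N
      (g := fun p => f p) (by fun_prop)
    refine h.trans_eq ?_
    congr 1
    rw [← ENNReal.ofReal_pow (by positivity), ← Real.exp_nat_mul, hvc]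
    congr 2
    field_simp
  have hSlim : ∀ ω, Tendsto (fun N => (S N N ω, partialSups (fun i => S N i ω) N)) atTop
      (𝓝 (withMax (fun s ω => x + W s ω + u s ω) t ω)) := by
    intro ω
    have he : Tendsto (fun N : ℕ => C * t * (N : ℝ)⁻¹) atTop (𝓝 0) := by
      simpa using tendsto_inv_atTop_nhds_zero_nat.const_mul (C * t)
    have hy : ∀ N i, i ≤ N →
        |S N i ω - (x + W (i / N * t) ω + u (i / N * t) ω)| ≤ C * t * (N : ℝ)⁻¹ := by
      intro N i _
      have := (hu.lip ω).dist_le_mul ((i - 1) / N * t) (i / N * t)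
      rw [Real.dist_eq, Real.dist_eq] at this
      rw [show S N i ω - (x + W (i / N * t) ω + u (i / N * t) ω) =
        u ((i - 1) / N * t) ω - u (i / N * t) ω by simp only [hS]; ring]
      refine this.trans_eq ?_
      rw [show ((i - 1) / N * t - i / N * t : ℝ) = -(t * (N : ℝ)⁻¹) by ring, abs_neg,
        abs_of_nonneg (by positivity), mul_assoc]
    have hcont : Continuous fun s => x + W s ω + u s ω :=
      (continuous_const.add (hWc ω)).add (hu.lip ω).continuous
    refine Tendsto.prodMk_nhds ?_ (tendsto_partialSups_grid hcont he hy)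
    rw [tendsto_iff_dist_tendsto_zero]
    refine squeeze_zero' (Eventually.of_forall fun _ => dist_nonneg) ?_ he
    filter_upwards [eventually_ne_atTop 0] with N hN
    have := hy N N le_rfl
    rwa [div_self (by exact_mod_cast hN), one_mul] at this
  have hRlim : ∀ ω, Tendsto (fun N => (R N N ω, partialSups (fun i => R N i ω) N)) atTop
      (𝓝 (withMax (fun s ω => x + W s ω) t ω)) := by
    intro ω
    have hcont : Continuous fun s => x + W s ω := continuous_const.add (hWc ω)
    refine Tendsto.prodMk_nhds ?_ (tendsto_partialSups_grid hcont (e := fun _ => 0)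
      tendsto_const_nhds (y := fun N i => R N i ω) (by simp [hR]))
    refine tendsto_const_nhds.congr' ?_
    filter_upwards [eventually_ne_atTop 0] with N hN
    simp only [hR]
    rw [div_self (by exact_mod_cast hN), one_mul]
  have hmeas : ∀ Q : ℕ → Ω → ℝ, (∀ i, Measurable (Q i)) → ∀ n,
      Measurable fun ω => (Q n ω, partialSups (fun i => Q i ω) n) := by
    intro Q hQ n
    refine (hQ n).prodMk ?_
    induction n with
    | zero => simpa using hQ 0
    | succ i ih =>
      simp only [← Order.succ_eq_add_one, partialSups_succ]
      exact ih.sup (hQ (i + 1))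
  obtain ⟨B, hB⟩ : ∃ B : ℝ≥0, ∀ p, f p ≤ B := ⟨nndist f 0, fun p => by
    simpa using f.nndist_coe_le_nndist (g := 0) p⟩
  have hSint : Tendsto (fun N => ∫⁻ ω, f (S N N ω, partialSups (fun i => S N i ω) N) ∂P) atTop
      (𝓝 (∫⁻ ω, f (withMax (fun s ω => x + W s ω + u s ω) t ω) ∂P)) := by
    refine tendsto_lintegral_of_dominated_convergence (fun _ => (B : ℝ≥0∞)) (fun N => ?_)
      (fun N => ae_of_all _ fun ω => by dsimp only; exact_mod_cast hB _) (by simp)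
      (ae_of_all _ fun ω => ?_)
    · have := hmeas (S N) (fun i => by simp only [hS]; fun_prop) N
      fun_prop
    · exact ENNReal.tendsto_coe.2 ((f.continuous.tendsto _).comp (hSlim ω))
  have hRint : Tendsto
      (fun N => ∫⁻ ω, (f (R N N ω, partialSups (fun i => R N i ω) N) : ℝ≥0∞) ^ 2 ∂P) atTop
      (𝓝 (∫⁻ ω, (f (withMax (fun s ω => x + W s ω) t ω) : ℝ≥0∞) ^ 2 ∂P)) := by
    refine tendsto_lintegral_of_dominated_convergence (fun _ => (B : ℝ≥0∞) ^ 2) (fun N => ?_)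
      (fun N => ae_of_all _ fun ω => by dsimp only; gcongr; exact hB _) (by simp)
      (ae_of_all _ fun ω => ?_)
    · have := hmeas (R N) (fun i => by simp only [hR]; fun_prop) N
      fun_prop
    · exact ENNReal.Tendsto.pow
        (ENNReal.tendsto_coe.2 ((f.continuous.tendsto _).comp (hRlim ω)))
  refine le_of_tendsto_of_tendsto (ENNReal.Tendsto.pow hSint)
    (ENNReal.Tendsto.const_mul hRint (Or.inr ENNReal.ofReal_ne_top)) ?_
  filter_upwards [eventually_ne_atTop 0] with N hN using key N hN

/-- The law of a Brownian motion with bounded drift and of its maximum is dominated by that of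
the Brownian motion. -/
lemma sq_measure_withMax_le (hW : IsStandardBrownianMotion P ℱ W) (x : ℝ)
    (hu : IsDrift C ℱ u) {t : ℝ} (ht : 0 < t) {A : Set (ℝ × ℝ)} (hA : MeasurableSet A) :
    P (withMax (fun s ω => x + W s ω + u s ω) t ⁻¹' A) ^ 2 ≤
      ENNReal.ofReal (Real.exp (C ^ 2 * t)) * P (withMax (fun s ω => x + W s ω) t ⁻¹' A) := by
  have hm : ∀ u, IsDrift C ℱ u → Measurable (withMax (fun s ω => x + W s ω + u s ω) t) :=
    fun u hu => (measurable_withMax (fun _ _ h => ℱ.mono h)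
      (fun ω => (continuous_const.add (hW.1 ω)).add (hu.lip ω).continuous)
      (fun s => ((hW.2.2.1 s).const_add x).add (hu.meas s)) ht.le).mono (ℱ.le t) le_rfl
  have hZ := hm u hu
  have hZ' := hm _ (isDrift_zero C ℱ)
  simp only [add_zero] at hZ'
  set Z := withMax (fun s ω => x + W s ω + u s ω) t
  set Z' := withMax (fun s ω => x + W s ω) t
  set e := ENNReal.ofReal (Real.exp (C ^ 2 * t))
  have hclosed : ∀ F, IsClosed F → P.map Z F ^ 2 ≤ e * P.map Z' F := by
    intro F hF
    have : IsProbabilityMeasure (P.map Z') := Measure.isProbabilityMeasure_map hZ'.aemeasurable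
    have hlim := ENNReal.Tendsto.const_mul (a := e)
      (HasOuterApproxClosed.tendsto_lintegral_apprSeq hF (P.map Z'))
      (Or.inr ENNReal.ofReal_ne_top)
    refine ge_of_tendsto' hlim fun n => ?_
    calc P.map Z F ^ 2 ≤ (∫⁻ p, hF.apprSeq n p ∂P.map Z) ^ 2 := by
          gcongr
          exact HasOuterApproxClosed.measure_le_lintegral hF _ n
      _ = (∫⁻ ω, hF.apprSeq n (Z ω) ∂P) ^ 2 := by
          rw [lintegral_map (by fun_prop) hZ]
      _ ≤ e * ∫⁻ ω, (hF.apprSeq n (Z' ω) : ℝ≥0∞) ^ 2 ∂P := sq_lintegral_withMax_le hW x hu ht _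
      _ ≤ e * ∫⁻ p, hF.apprSeq n p ∂P.map Z' := by
          rw [lintegral_map (by fun_prop) hZ']
          gcongr with ω
          have h1 : (hF.apprSeq n (Z' ω) : ℝ≥0∞) ≤ 1 := by
            exact_mod_cast HasOuterApproxClosed.apprSeq_apply_le_one hF n (Z' ω)
          rw [sq]
          exact mul_le_of_le_one_left' h1
  rw [← Measure.map_apply hZ hA, ← Measure.map_apply hZ' hA]
  have : IsProbabilityMeasure (P.map Z) := Measure.isProbabilityMeasure_map hZ.aemeasurable
  rw [← ENNReal.rpow_natCast]
  rw [← ENNReal.le_rpow_inv_iff (by norm_num)]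
  rw [hA.measure_eq_iSup_isClosed_of_ne_top (measure_ne_top _ _)]
  refine iSup₂_le fun F hFA => iSup_le fun hF => ?_
  rw [ENNReal.le_rpow_inv_iff (by norm_num), ENNReal.rpow_natCast]
  exact (hclosed F hF).trans (by gcongr)

end Girsanov

/-- The drift `g` evaluated along a path and its running maximum. -/
noncomputable def driftAlong (g : ℝ × ℝ → ℝ) (f : ℝ → ℝ) (s : ℝ) : ℝ := g (f s, runMax f s)

lemma continuous_driftAlong {g : ℝ × ℝ → ℝ} (hg : Continuous g) {f : ℝ → ℝ} (hf : Continuous f) :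
    Continuous (driftAlong g f) :=
  hg.comp (hf.prodMk (continuous_runMax hf))

/-- `u` is the drift part of a solution `c + u` of the equation with driving path `c`. -/
def IsSol (g : ℝ × ℝ → ℝ) (c u : ℝ → ℝ) : Prop :=
  ∀ t, u t = ∫ s in (0 : ℝ)..max t 0, driftAlong g (fun r => c r + u r) s

/-- Continuous coefficients bounded by `C`, nondecreasing in the second variable, and
nondecreasing in the first variable up to a linear term with slope `L`. -/
structure IsRegularDrift (C : ℝ≥0) (L : ℝ) (g : ℝ × ℝ → ℝ) : Prop where
  cont : Continuous g
  bdd : ∀ p, |g p| ≤ C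
  mono : ∀ x y y', y ≤ y' → g (x, y) ≤ g (x, y')
  slope : ∀ x x' y, x ≤ x' → g (x, y) + L * x ≤ g (x', y) + L * x'

/-- The integrand of the Picard operator after multiplication by an integrating factor. -/
noncomputable def picardIntegrand (g : ℝ × ℝ → ℝ) (L : ℝ) (c u : ℝ → ℝ) (s : ℝ) : ℝ :=
  Real.exp (L * s) * (driftAlong g (fun r => c r + u r) s + L * u s)

/-- The Picard operator with integrating factor. -/
noncomputable def picard (g : ℝ × ℝ → ℝ) (L : ℝ) (c u : ℝ → ℝ) (t : ℝ) : ℝ :=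
  Real.exp (-(L * max t 0)) * ∫ s in (0 : ℝ)..max t 0, picardIntegrand g L c u s

/-- Picard iterates started from the lowest possible drift. -/
noncomputable def picardIter (C : ℝ) (g : ℝ × ℝ → ℝ) (L : ℝ) (c : ℝ → ℝ) : ℕ → ℝ → ℝ
  | 0, t => -(C * max t 0)
  | p + 1, t => picard g L c (picardIter C g L c p) t

lemma exp_mul_integral_eq {L T : ℝ} (hT : 0 ≤ T) {h u : ℝ → ℝ} (hh : Continuous h)
    (hu : ∀ t, 0 ≤ t → u t = ∫ s in (0 : ℝ)..t, h s) :
    Real.exp (L * T) * u T = ∫ s in (0 : ℝ)..T, Real.exp (L * s) * (h s + L * u s) := by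
  have hc : Continuous fun t => ∫ s in (0 : ℝ)..t, h s :=
    intervalIntegral.continuous_primitive (fun a b => hh.intervalIntegrable a b) 0
  have hd : ∀ t ∈ uIcc 0 T, HasDerivAt (fun t => Real.exp (L * t) * ∫ s in (0 : ℝ)..t, h s)
      (Real.exp (L * t) * (h t + L * ∫ s in (0 : ℝ)..t, h s)) t := by
    intro t _
    have h1 : HasDerivAt (fun t => ∫ s in (0 : ℝ)..t, h s) (h t) t :=
      intervalIntegral.integral_hasDerivAt_right (hh.intervalIntegrable _ _)
        (hh.stronglyMeasurableAtFilter _ _) hh.continuousAt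
    have h2 : HasDerivAt (fun t => Real.exp (L * t)) (Real.exp (L * t) * (L * 1)) t :=
      ((hasDerivAt_id t).const_mul L).exp
    refine (h2.mul h1).congr_deriv ?_
    ring
  have := intervalIntegral.integral_eq_sub_of_hasDerivAt hd
    (Continuous.intervalIntegrable (by fun_prop) _ _)
  simp only [intervalIntegral.integral_same, mul_zero, sub_zero] at this
  rw [hu T hT, ← this]
  refine intervalIntegral.integral_congr fun s hs => ?_
  rw [uIcc_of_le hT] at hs
  simp only [hu s hs.1]

lemma eq_integral_of_exp_mul {L T : ℝ} (hT : 0 ≤ T) {h u : ℝ → ℝ} (hh : Continuous h)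
    (huc : Continuous u)
    (hu : ∀ t, 0 ≤ t →
      u t = Real.exp (-(L * t)) * ∫ s in (0 : ℝ)..t, Real.exp (L * s) * (h s + L * u s)) :
    u T = ∫ s in (0 : ℝ)..T, h s := by
  set φ : ℝ → ℝ := fun s => Real.exp (L * s) * (h s + L * u s) with hφ
  have hφc : Continuous φ := by fun_prop
  have hc : Continuous fun t => ∫ s in (0 : ℝ)..t, φ s :=
    intervalIntegral.continuous_primitive (fun a b => hφc.intervalIntegrable a b) 0
  have hd : ∀ t ∈ uIcc 0 T, HasDerivAt (fun t => Real.exp (-(L * t)) * ∫ s in (0 : ℝ)..t, φ s)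
      (h t + L * u t - L * (Real.exp (-(L * t)) * ∫ s in (0 : ℝ)..t, φ s)) t := by
    intro t _
    have h1 : HasDerivAt (fun t => ∫ s in (0 : ℝ)..t, φ s) (φ t) t :=
      intervalIntegral.integral_hasDerivAt_right (hφc.intervalIntegrable _ _)
        (hφc.stronglyMeasurableAtFilter _ _) hφc.continuousAt
    have h2 : HasDerivAt (fun t => Real.exp (-(L * t))) (Real.exp (-(L * t)) * (-(L * 1))) t :=
      ((hasDerivAt_id t).const_mul L).neg.exp
    refine (h2.mul h1).congr_deriv ?_
    have h3 : Real.exp (-(L * t)) * Real.exp (L * t) = 1 := by rw [← Real.exp_add]; simp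
    simp only [hφ]
    linear_combination (h t + L * u t) * h3
  have := intervalIntegral.integral_eq_sub_of_hasDerivAt hd
    (Continuous.intervalIntegrable (by fun_prop) _ _)
  simp only [intervalIntegral.integral_same, mul_zero, sub_zero] at this
  rw [hu T hT, ← this]
  refine intervalIntegral.integral_congr fun s hs => ?_
  rw [uIcc_of_le hT] at hs
  simp only [← hu s hs.1]
  ring

lemma IsSol.eq_picard {g : ℝ × ℝ → ℝ} (hg : Continuous g) {c u : ℝ → ℝ} (hc : Continuous c)
    (huc : Continuous u) (hu : IsSol g c u) (L : ℝ) (t : ℝ) : u t = picard g L c u t := by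
  have hcu : Continuous fun r => c r + u r := hc.add huc
  have h := exp_mul_integral_eq (L := L) (u := u) (le_max_right t 0)
    (continuous_driftAlong hg hcu) (fun s hs => by
      have := hu s
      rwa [max_eq_left hs] at this)
  have h0 : u (max t 0) = u t := by rw [hu, hu t, max_eq_left (le_max_right t 0)]
  unfold picard picardIntegrand
  rw [← h, ← mul_assoc, ← Real.exp_add, h0]
  simp

section Picard

variable {C : ℝ≥0} {L : ℝ} {g : ℝ × ℝ → ℝ} {c : ℝ → ℝ}

lemma continuous_picardIntegrand (hg : Continuous g) (hc : Continuous c) {u : ℝ → ℝ}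
    (hu : Continuous u) : Continuous (picardIntegrand g L c u) := by
  have hcu : Continuous fun r => c r + u r := hc.add hu
  have := continuous_driftAlong hg hcu
  unfold picardIntegrand
  fun_prop

lemma continuous_picard {u : ℝ → ℝ}
    (h : ∀ a b, IntervalIntegrable (picardIntegrand g L c u) volume a b) :
    Continuous (picard g L c u) := by
  have : Continuous fun t : ℝ => ∫ s in (0 : ℝ)..max t 0, picardIntegrand g L c u s :=
    (intervalIntegral.continuous_primitive h 0).comp (continuous_id.max continuous_const)
  unfold picard
  fun_prop

lemma picard_mono (hg : IsRegularDrift C L g) (hc : Continuous c) {u v : ℝ → ℝ}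
    (hu : Continuous u) (hv : Continuous v) (h : ∀ t, u t ≤ v t) (t : ℝ) :
    picard g L c u t ≤ picard g L c v t := by
  unfold picard
  gcongr
  refine intervalIntegral.integral_mono_on (le_max_right _ _)
    ((continuous_picardIntegrand hg.cont hc hu).intervalIntegrable _ _)
    ((continuous_picardIntegrand hg.cont hc hv).intervalIntegrable _ _) fun s _ => ?_
  unfold picardIntegrand driftAlong
  gcongr ?_ * ?_
  have h1 := hg.slope (c s + u s) (c s + v s) (runMax (fun r => c r + u r) s) (by linarith [h s])
  have h2 := hg.mono (c s + v s) _ _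
    (runMax_mono (f := fun r => c r + u r) (g := fun r => c r + v r) (hc.add hv)
      (fun r => add_le_add_right (h r) _) s)
  linarith

lemma picard_mono_left {g₂ : ℝ × ℝ → ℝ} (hg : Continuous g) (hg₂ : Continuous g₂)
    (hc : Continuous c) (h : ∀ p, g p ≤ g₂ p) {u : ℝ → ℝ} (hu : Continuous u) (t : ℝ) :
    picard g L c u t ≤ picard g₂ L c u t := by
  unfold picard
  gcongr
  refine intervalIntegral.integral_mono_on (le_max_right _ _)
    ((continuous_picardIntegrand hg hc hu).intervalIntegrable _ _)
    ((continuous_picardIntegrand hg₂ hc hu).intervalIntegrable _ _) fun s _ => ?_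
  unfold picardIntegrand driftAlong
  gcongr
  exact h _

/-- The linear drift with slope `k` is a fixed point of the Picard operator for a constant. -/
lemma linear_eq_picard (c : ℝ → ℝ) (k L t : ℝ) (hc : Continuous c) :
    k * max t 0 = picard (fun _ => k) L c (fun t => k * max t 0) t := by
  refine IsSol.eq_picard (u := fun t => k * max t 0) continuous_const hc (by fun_prop) ?_ L t
  intro t
  simp [driftAlong, mul_comm]

lemma continuous_picardIter (hg : Continuous g) (hc : Continuous c) (p : ℕ) :
    Continuous (picardIter C g L c p) := by
  induction p with
  | zero => show Continuous fun t => -((C : ℝ) * max t 0); fun_prop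
  | succ p ih => exact continuous_picard fun a b =>
      (continuous_picardIntegrand hg hc ih).intervalIntegrable a b

lemma picardIter_le (hg : IsRegularDrift C L g) (hc : Continuous c) {g₂ : ℝ × ℝ → ℝ}
    (hg₂ : Continuous g₂) (h : ∀ p, g p ≤ g₂ p) {u : ℝ → ℝ} (hu : Continuous u)
    (hlow : ∀ t, -(C * max t 0) ≤ u t) (hfix : ∀ t, picard g₂ L c u t ≤ u t) (p : ℕ) (t : ℝ) :
    picardIter C g L c p t ≤ u t := by
  induction p generalizing t with
  | zero => exact hlow t
  | succ p ih =>
    exact (picard_mono hg hc (continuous_picardIter hg.cont hc p) hu ih t).trans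
      ((picard_mono_left hg.cont hg₂ hc h hu t).trans (hfix t))

lemma picardIter_le_linear (hg : IsRegularDrift C L g) (hc : Continuous c) (p : ℕ) (t : ℝ) :
    picardIter C g L c p t ≤ C * max t 0 :=
  picardIter_le hg hc (g₂ := fun _ => C) (u := fun t => C * max t 0) continuous_const
    (fun q => (le_abs_self _).trans (hg.bdd q)) (by fun_prop)
    (fun t => by have : 0 ≤ C * max t 0 := by positivity
                 linarith)
    (fun t => (linear_eq_picard c C L t hc).ge) p t

lemma picardIter_le_succ (hg : IsRegularDrift C L g) (hc : Continuous c) (p : ℕ) (t : ℝ) :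
    picardIter C g L c p t ≤ picardIter C g L c (p + 1) t := by
  induction p generalizing t with
  | zero =>
    have h1 := linear_eq_picard c (-C) L t hc
    have h2 := picard_mono_left (L := L) (c := c) (g := fun _ => (-C : ℝ)) continuous_const hg.cont
      hc (fun q => (abs_le.1 (hg.bdd q)).1) (u := fun t => -C * max t 0) (by fun_prop) t
    simp only [picardIter, ← neg_mul]
    linarith
  | succ p ih =>
    exact picard_mono hg hc (continuous_picardIter hg.cont hc p)
      (continuous_picardIter hg.cont hc (p + 1)) ih t

lemma neg_linear_le_picardIter (hg : IsRegularDrift C L g) (hc : Continuous c) (p : ℕ) (t : ℝ) :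
    -(C * max t 0) ≤ picardIter C g L c p t :=
  monotone_nat_of_le_succ (f := fun p => picardIter C g L c p t)
    (fun p => picardIter_le_succ hg hc p t) (Nat.zero_le p)

/-- The limit of the Picard iterates. -/
noncomputable def picardLimit (C : ℝ) (g : ℝ × ℝ → ℝ) (L : ℝ) (c : ℝ → ℝ) (t : ℝ) : ℝ :=
  ⨆ p, picardIter C g L c p t

lemma tendsto_picardIter (hg : IsRegularDrift C L g) (hc : Continuous c) (t : ℝ) :
    Tendsto (fun p => picardIter C g L c p t) atTop (𝓝 (picardLimit C g L c t)) :=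
  tendsto_atTop_ciSup (monotone_nat_of_le_succ fun p => picardIter_le_succ hg hc p t)
    ⟨C * max t 0, by rintro _ ⟨p, rfl⟩; exact picardIter_le_linear hg hc p t⟩

lemma tendsto_runMax_of_monotone {v : ℕ → ℝ → ℝ} {f b : ℝ → ℝ} (hv : ∀ p, Continuous (v p))
    (hmono : ∀ t, Monotone fun p => v p t) (h : ∀ t, Tendsto (fun p => v p t) atTop (𝓝 (f t)))
    (hb : Continuous b) (hfb : ∀ t, f t ≤ b t) (s : ℝ) :
    Tendsto (fun p => runMax (v p) s) atTop (𝓝 (runMax f s)) := by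
  have hbdd : BddAbove ((fun r => f (r * s)) '' Icc 0 1) :=
    ⟨runMax b s, by rintro _ ⟨r, hr, rfl⟩; exact (hfb _).trans (le_runMax hb hr)⟩
  refine tendsto_atTop_isLUB (fun p q hpq => runMax_mono (hv q) (fun t => hmono t hpq) s)
    ⟨?_, fun a ha => ?_⟩
  · rintro _ ⟨p, rfl⟩
    exact runMax_le fun r hr => ((hmono (r * s)).ge_of_tendsto (h _) p).trans
      (le_csSup hbdd ⟨r, hr, rfl⟩)
  · exact runMax_le fun r hr => le_of_tendsto' (h (r * s)) fun p =>
      (le_runMax (hv p) hr).trans (ha ⟨p, rfl⟩)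

lemma picardLimit_le_linear (hg : IsRegularDrift C L g) (hc : Continuous c) (t : ℝ) :
    picardLimit C g L c t ≤ C * max t 0 :=
  le_of_tendsto' (tendsto_picardIter hg hc t) fun p => picardIter_le_linear hg hc p t

lemma tendsto_picardIntegrand (hg : IsRegularDrift C L g) (hc : Continuous c) (s : ℝ) :
    Tendsto (fun p => picardIntegrand g L c (picardIter C g L c p) s) atTop
      (𝓝 (picardIntegrand g L c (picardLimit C g L c) s)) := by
  have h1 := tendsto_picardIter hg hc s
  have h2 := tendsto_runMax_of_monotone (v := fun p r => c r + picardIter C g L c p r)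
    (f := fun r => c r + picardLimit C g L c r) (b := fun r => c r + C * max r 0)
    (fun p => hc.add (continuous_picardIter hg.cont hc p))
    (fun t => (monotone_nat_of_le_succ fun p => by
      linarith [picardIter_le_succ (L := L) hg hc p t]))
    (fun t => (tendsto_picardIter hg hc t).const_add _) (by fun_prop)
    (fun t => by linarith [picardLimit_le_linear (L := L) hg hc t]) s
  exact (((hg.cont.tendsto _).comp ((h1.const_add _).prodMk_nhds h2)).add
    (h1.const_mul _)).const_mul _

lemma abs_picardIntegrand_le (hg : IsRegularDrift C L g) (hc : Continuous c) (hL : 0 ≤ L)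
    (p : ℕ) (s : ℝ) :
    |picardIntegrand g L c (picardIter C g L c p) s| ≤
      Real.exp (L * s) * (C + L * (C * max s 0)) := by
  unfold picardIntegrand driftAlong
  rw [abs_mul, abs_of_pos (Real.exp_pos _)]
  gcongr
  refine (abs_add_le _ _).trans ?_
  rw [abs_mul, abs_of_nonneg hL]
  gcongr
  · exact hg.bdd _
  · exact abs_le.2 ⟨neg_linear_le_picardIter hg hc p s, picardIter_le_linear hg hc p s⟩

lemma picardLimit_eq_picard (hg : IsRegularDrift C L g) (hc : Continuous c) (hL : 0 ≤ L) (t : ℝ) :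
    picardLimit C g L c t = picard g L c (picardLimit C g L c) t := by
  refine tendsto_nhds_unique ((tendsto_picardIter hg hc t).comp (tendsto_add_atTop_nat 1)) ?_
  refine Tendsto.const_mul _ ?_
  refine intervalIntegral.tendsto_integral_filter_of_dominated_convergence
    (fun s => Real.exp (L * s) * (C + L * (C * max s 0)))
    (Eventually.of_forall fun p => (continuous_picardIntegrand hg.cont hc
      (continuous_picardIter hg.cont hc p)).aestronglyMeasurable)
    (Eventually.of_forall fun p => ae_of_all _ fun s _ => abs_picardIntegrand_le hg hc hL p s)
    (Continuous.intervalIntegrable (by fun_prop) _ _)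
    (ae_of_all _ fun s _ => tendsto_picardIntegrand hg hc s)

lemma continuous_picardLimit (hg : IsRegularDrift C L g) (hc : Continuous c) (hL : 0 ≤ L) :
    Continuous (picardLimit C g L c) := by
  rw [funext (picardLimit_eq_picard hg hc hL)]
  refine continuous_picard fun a b => ?_
  have hm : Measurable (picardIntegrand g L c (picardLimit C g L c)) :=
    measurable_of_tendsto_metrizable (fun p => (continuous_picardIntegrand (L := L) hg.cont hc
      (continuous_picardIter hg.cont hc p)).measurable)
      (tendsto_pi_nhds.2 fun s => tendsto_picardIntegrand hg hc s)
  refine IntervalIntegrable.mono_fun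
    (g := picardIntegrand g L c (picardLimit C g L c))
    (f := fun s => Real.exp (L * s) * (C + L * (C * max s 0)))
    (Continuous.intervalIntegrable (by fun_prop) _ _) hm.aestronglyMeasurable
    (ae_of_all _ fun s => ?_)
  exact (le_of_tendsto' (tendsto_picardIntegrand hg hc s).abs
    fun p => abs_picardIntegrand_le hg hc hL p s).trans (le_abs_self _)

lemma isSol_picardLimit (hg : IsRegularDrift C L g) (hc : Continuous c) (hL : 0 ≤ L) :
    IsSol g c (picardLimit C g L c) := by
  have hcont := continuous_picardLimit hg hc hL
  have h0 : ∀ t, picardLimit C g L c (max t 0) = picardLimit C g L c t := fun t => by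
    rw [picardLimit_eq_picard hg hc hL, picardLimit_eq_picard hg hc hL t, picard, picard,
      max_eq_left (le_max_right t 0)]
  intro t
  rw [← h0 t]
  refine eq_integral_of_exp_mul (L := L) (le_max_right t 0)
    (continuous_driftAlong hg.cont (hc.add hcont)) hcont fun s hs => ?_
  have := picardLimit_eq_picard hg hc hL s
  rwa [picard, max_eq_left hs] at this

lemma IsSol.lipschitz (hg : IsRegularDrift C L g) (hc : Continuous c) {u : ℝ → ℝ}
    (hu : Continuous u) (h : IsSol g c u) : LipschitzWith C u := by
  have hcu : Continuous fun r => c r + u r := hc.add hu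
  have hd := continuous_driftAlong hg.cont hcu
  refine LipschitzWith.of_dist_le_mul fun s t => ?_
  rw [Real.dist_eq, h s, h t, intervalIntegral.integral_interval_sub_left
    (hd.intervalIntegrable _ _) (hd.intervalIntegrable _ _)]
  refine (intervalIntegral.norm_integral_le_of_norm_le_const (C := C)
    (f := driftAlong g fun r => c r + u r) fun r _ => hg.bdd _).trans ?_
  gcongr
  exact (abs_max_sub_max_le_abs _ _ _)

/-- Comparison: the Picard limit lies below any solution for a larger coefficient. -/
lemma picardLimit_le (hg : IsRegularDrift C L g) (hc : Continuous c) {g₂ : ℝ × ℝ → ℝ}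
    (hg₂ : Continuous g₂) (h : ∀ p, g p ≤ g₂ p) {u : ℝ → ℝ} (hu : LipschitzWith C u)
    (hsol : IsSol g₂ c u) (t : ℝ) : picardLimit C g L c t ≤ u t := by
  refine le_of_tendsto' (tendsto_picardIter hg hc t) fun p =>
    picardIter_le hg hc hg₂ h hu.continuous (fun t => ?_)
      (fun t => (hsol.eq_picard hg₂ hc hu.continuous L t).ge) p t
  have h0 : u t = u (max t 0) := by rw [hsol, hsol (max t 0), max_eq_left (le_max_right t 0)]
  have h1 : u 0 = 0 := by rw [hsol]; simp
  have := hu.dist_le_mul (max t 0) 0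
  rw [Real.dist_eq, Real.dist_eq, h1, sub_zero, sub_zero, abs_of_nonneg (le_max_right t 0)] at this
  rw [h0]
  exact (abs_le.1 this).1

end Picard

section Adapted

variable {Ω : Type*} {𝒢 : ℝ → MeasurableSpace Ω}

lemma measurable_integral_of_adapted (h𝒢 : Monotone 𝒢) {φ : ℝ → Ω → ℝ}
    (hc : ∀ ω, Continuous fun s => φ s ω) (hφ : ∀ s, 0 ≤ s → Measurable[𝒢 s] (φ s)) {t : ℝ}
    (ht : 0 ≤ t) : Measurable[𝒢 t] fun ω => ∫ s in (0 : ℝ)..t, φ s ω := by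
  let _ : MeasurableSpace Ω := 𝒢 t
  have hψ : Measurable (Function.uncurry fun s ω => φ (min (max s 0) t) ω) :=
    measurable_uncurry_of_continuous_of_measurable
      (fun ω => (hc ω).comp ((continuous_id.max continuous_const).min continuous_const))
      (fun s => (hφ _ (le_min (le_max_right _ _) ht)).mono (h𝒢 (min_le_right _ _)) le_rfl)
  have heq : (fun ω => ∫ s in (0 : ℝ)..t, φ s ω) =
      fun ω => ∫ s in (0 : ℝ)..t, φ (min (max s 0) t) ω := by
    ext ω
    refine intervalIntegral.integral_congr fun s hs => ?_
    rw [uIcc_of_le ht] at hs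
    simp [hs.1, hs.2]
  rw [heq]
  simp_rw [intervalIntegral.integral_of_le ht]
  exact (hψ.comp measurable_swap).stronglyMeasurable.integral_prod_right'.measurable

lemma measurable_picardIter (h𝒢 : Monotone 𝒢) {C : ℝ≥0} {L : ℝ} {g : ℝ × ℝ → ℝ}
    (hg : Continuous g) {X : ℝ → Ω → ℝ} (hc : ∀ ω, Continuous fun s => X s ω)
    (hX : ∀ t, Measurable[𝒢 t] (X t)) (p : ℕ) (t : ℝ) :
    Measurable[𝒢 t] fun ω => picardIter C g L (fun s => X s ω) p t := by
  induction p generalizing t with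
  | zero => exact measurable_const
  | succ p ih =>
    rcases le_total t 0 with ht | ht
    · simp only [picardIter, picard, max_eq_right ht, intervalIntegral.integral_same]
      exact measurable_const
    · simp only [picardIter, picard, max_eq_left ht]
      refine Measurable.const_mul (measurable_integral_of_adapted h𝒢 (fun ω =>
        continuous_picardIntegrand hg (hc ω) (continuous_picardIter hg (hc ω) p))
        (fun s hs => ?_) ht) _
      have h1 := measurable_withMax h𝒢
        (X := fun s ω => X s ω + picardIter C g L (fun s => X s ω) p s)
        (fun ω => (hc ω).add (continuous_picardIter hg (hc ω) p))
        (fun s => (hX s).add (ih s)) hs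
      exact ((hg.measurable.comp h1).add ((ih s).const_mul L)).const_mul _

lemma isDrift_picardLimit (h𝒢 : Monotone 𝒢) {C : ℝ≥0} {L : ℝ} (hL : 0 ≤ L) {g : ℝ × ℝ → ℝ}
    (hg : IsRegularDrift C L g) {X : ℝ → Ω → ℝ} (hc : ∀ ω, Continuous fun s => X s ω)
    (hX : ∀ t, Measurable[𝒢 t] (X t)) :
    IsDrift C 𝒢 fun t ω => picardLimit C g L (fun s => X s ω) t where
  lip ω := (isSol_picardLimit hg (hc ω) hL).lipschitz hg (hc ω)
    (continuous_picardLimit hg (hc ω) hL)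
  zero t ht ω := by rw [isSol_picardLimit hg (hc ω) hL t, max_eq_right ht]; simp
  meas t := by
    let _ : MeasurableSpace Ω := 𝒢 t
    exact measurable_of_tendsto_metrizable (fun p => measurable_picardIter h𝒢 hg.cont hc hX p t)
      (tendsto_pi_nhds.2 fun ω => tendsto_picardIter hg (hc ω) t)

end Adapted

section Stability

variable {Ω : Type*} {m : MeasurableSpace Ω} {P : Measure Ω}

section Dominated

variable {E : Type*} [MeasurableSpace E] {ι : Type*} {l : Filter ι} {K B : ℝ≥0∞}

/-- Dominated convergence for random variables whose laws are uniformly controlled by the law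
of `Z'`. -/
lemma tendsto_lintegral_of_sq_measure_le [IsProbabilityMeasure P] [l.IsCountablyGenerated]
    {Z : ι → Ω → E} (hZ : ∀ i, Measurable (Z i)) {Z' : Ω → E} (hZ' : Measurable Z') (hK : K ≠ ∞)
    (h : ∀ i A, MeasurableSet A → P (Z i ⁻¹' A) ^ 2 ≤ K * P (Z' ⁻¹' A))
    {f : ι → E → ℝ≥0∞} (hf : ∀ i, Measurable (f i)) (hB : B ≠ ∞) (hfB : ∀ i p, f i p ≤ B)
    (hlim : ∀ᵐ ω ∂P, Tendsto (fun i => f i (Z' ω)) l (𝓝 0)) :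
    Tendsto (fun i => ∫⁻ ω, f i (Z i ω) ∂P) l (𝓝 0) := by
  have h1 : Tendsto (fun i => ∫⁻ ω, f i (Z' ω) ∂P) l (𝓝 0) := by
    have := tendsto_lintegral_filter_of_dominated_convergence (μ := P) (l := l)
      (F := fun i ω => f i (Z' ω)) (f := fun _ => 0) (fun _ => B)
      (Eventually.of_forall fun i => (hf i).comp hZ')
      (Eventually.of_forall fun i => ae_of_all _ fun ω => hfB i _)
      (by simpa using hB) hlim
    simpa using this
  rw [ENNReal.tendsto_nhds_zero]
  intro ε hε
  rcases eq_or_ne ε ∞ with rfl | hεt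
  · simp
  set δ := ε / 2 with hδ
  have hδ0 : δ ≠ 0 := (ENNReal.half_pos hε.ne').ne'
  have hδt : δ ≠ ∞ := ENNReal.div_ne_top hεt (by simp)
  have hA : ∀ i, MeasurableSet {p | δ ≤ f i p} := fun i => measurableSet_le measurable_const (hf i)
  have h2 : Tendsto (fun i => B * (K * ((∫⁻ ω, f i (Z' ω) ∂P) / δ)) ^ (2⁻¹ : ℝ)) l (𝓝 0) := by
    have h3 : Tendsto (fun i => (∫⁻ ω, f i (Z' ω) ∂P) / δ) l (𝓝 (0 / δ)) :=
      ENNReal.Tendsto.div_const h1 (Or.inr hδ0)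
    have h4 := ENNReal.Tendsto.const_mul (a := K) h3 (Or.inr hK)
    have h5 := ENNReal.Tendsto.const_mul (a := B)
      ((ENNReal.continuous_rpow_const (y := (2⁻¹ : ℝ))).tendsto _ |>.comp h4) (Or.inr hB)
    simpa using h5
  filter_upwards [ENNReal.tendsto_nhds_zero.1 h2 δ (pos_iff_ne_zero.2 hδ0)] with i hi
  have h6 : P (Z i ⁻¹' {p | δ ≤ f i p}) ≤
      (K * ((∫⁻ ω, f i (Z' ω) ∂P) / δ)) ^ (2⁻¹ : ℝ) := by
    rw [ENNReal.le_rpow_inv_iff (by norm_num), ENNReal.rpow_two]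
    refine (h i _ (hA i)).trans ?_
    gcongr
    rw [ENNReal.le_div_iff_mul_le (Or.inl hδ0) (Or.inl hδt), mul_comm]
    exact mul_meas_ge_le_lintegral ((hf i).comp hZ') δ
  calc ∫⁻ ω, f i (Z i ω) ∂P
      ≤ ∫⁻ ω, (δ + (Z i ⁻¹' {p | δ ≤ f i p}).indicator (fun _ => B) ω) ∂P := by
        refine lintegral_mono fun ω => ?_
        by_cases hω : δ ≤ f i (Z i ω)
        · rw [indicator_of_mem (show ω ∈ Z i ⁻¹' {p | δ ≤ f i p} from hω)]
          exact (hfB i _).trans le_add_self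
        · exact (not_le.1 hω).le.trans le_self_add
    _ = δ + B * P (Z i ⁻¹' {p | δ ≤ f i p}) := by
        rw [lintegral_add_left measurable_const, lintegral_indicator_const (hZ i (hA i))]
        simp
    _ ≤ δ + B * (K * ((∫⁻ ω, f i (Z' ω) ∂P) / δ)) ^ (2⁻¹ : ℝ) := by gcongr
    _ ≤ δ + δ := by gcongr
    _ = ε := ENNReal.add_halves ε

lemma enorm_sub_le_of_abs_le {C : ℝ≥0} {a b : ℝ} (ha : |a| ≤ C) (hb : |b| ≤ C) :
    ‖a - b‖ₑ ≤ C + C := by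
  refine (enorm_sub_le).trans ?_
  gcongr
  · rw [← ofReal_norm, Real.norm_eq_abs]
    exact ENNReal.ofReal_le_of_le_toReal (by simpa using ha)
  · rw [← ofReal_norm, Real.norm_eq_abs]
    exact ENNReal.ofReal_le_of_le_toReal (by simpa using hb)

/-- Convergence of `g j (Z j)` to `h (Z')` for merely measurable coefficients, provided that the
laws of the arguments are controlled by a single law for which the coefficients converge. -/
lemma tendsto_lintegral_enorm_sub [IsProbabilityMeasure P] [TopologicalSpace E]
    [BorelSpace E] {Z : ℕ → Ω → E} {V : Ω → E} {Z' : Ω → E} (hZ : ∀ i, Measurable (Z i))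
    (hV : Measurable V) (hZ' : Measurable Z') (hK : K ≠ ∞)
    (hZK : ∀ i A, MeasurableSet A → P (Z i ⁻¹' A) ^ 2 ≤ K * P (Z' ⁻¹' A))
    (hVK : ∀ A, MeasurableSet A → P (V ⁻¹' A) ^ 2 ≤ K * P (Z' ⁻¹' A))
    (hlim : ∀ ω, Tendsto (fun j => Z j ω) atTop (𝓝 (V ω)))
    {C : ℝ≥0} {g φ : ℕ → E → ℝ} {h : E → ℝ} (hg : ∀ j, Measurable (g j)) (hh : Measurable h)
    (hφ : ∀ k, Continuous (φ k)) (hgC : ∀ j p, |g j p| ≤ C) (hhC : ∀ p, |h p| ≤ C)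
    (hφC : ∀ k p, |φ k p| ≤ C)
    (hgh : ∀ᵐ ω ∂P, Tendsto (fun j => g j (Z' ω)) atTop (𝓝 (h (Z' ω))))
    (hφh : ∀ᵐ ω ∂P, Tendsto (fun k => φ k (Z' ω)) atTop (𝓝 (h (Z' ω)))) :
    Tendsto (fun j => ∫⁻ ω, ‖g j (Z j ω) - h (V ω)‖ₑ ∂P) atTop (𝓝 0) := by
  have hB : (C + C : ℝ≥0∞) ≠ ∞ := by simp
  have hen : ∀ {ι : Type} {l : Filter ι} {a : ι → ℝ} {b : ℝ}, Tendsto a l (𝓝 b) →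
      Tendsto (fun i => ‖a i - b‖ₑ) l (𝓝 0) := fun {ι l a b} hab => by
    simpa only [sub_self, enorm_zero] using (hab.sub_const b).enorm
  have t1 := tendsto_lintegral_of_sq_measure_le hZ hZ' hK hZK (l := atTop)
    (f := fun j p => ‖g j p - h p‖ₑ) (fun j => ((hg j).sub hh).enorm) hB
    (fun j p => enorm_sub_le_of_abs_le (hgC j p) (hhC p)) (hgh.mono fun ω hω => hen hω)
  have t2 := tendsto_lintegral_of_sq_measure_le (ι := ℕ × ℕ) (Z := fun i => Z i.2)
    (l := comap Prod.fst atTop) (fun i => hZ _) hZ' hK (fun i => hZK _)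
    (f := fun i p => ‖φ i.1 p - h p‖ₑ) (fun i => ((hφ _).measurable.sub hh).enorm) hB
    (fun j p => enorm_sub_le_of_abs_le (hφC _ p) (hhC p))
    (hφh.mono fun ω hω => hen (hω.comp tendsto_comap))
  have t3 := tendsto_lintegral_of_sq_measure_le (Z := fun _ : ℕ => V) (l := atTop)
    (fun _ => hV) hZ' hK (fun _ => hVK) (f := fun k p => ‖φ k p - h p‖ₑ)
    (fun i => ((hφ _).measurable.sub hh).enorm) hB
    (fun j p => enorm_sub_le_of_abs_le (hφC _ p) (hhC p)) (hφh.mono fun ω hω => hen hω)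
  have t4 : ∀ k, Tendsto (fun j => ∫⁻ ω, ‖φ k (Z j ω) - φ k (V ω)‖ₑ ∂P) atTop (𝓝 0) := by
    intro k
    have := tendsto_lintegral_of_dominated_convergence (μ := P)
      (F := fun j ω => ‖φ k (Z j ω) - φ k (V ω)‖ₑ) (f := fun _ => 0) (fun _ => C + C)
      (fun j => (((hφ k).measurable.comp (hZ j)).sub ((hφ k).measurable.comp hV)).enorm)
      (fun j => ae_of_all _ fun ω => enorm_sub_le_of_abs_le (hφC _ _) (hφC _ _))
      (by simp) (ae_of_all _ fun ω => hen (((hφ k).tendsto _).comp (hlim ω)))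
    simpa using this
  rw [ENNReal.tendsto_nhds_zero] at t1 t2 t3 ⊢
  intro ε hε
  set δ := ε / 4 with hδ
  have hδ0 : 0 < δ := ENNReal.div_pos hε.ne' (by simp)
  obtain ⟨k, hk2, hk3⟩ := ((eventually_comap.1 (t2 δ hδ0)).and (t3 δ hδ0)).exists
  filter_upwards [t1 δ hδ0, ENNReal.tendsto_nhds_zero.1 (t4 k) δ hδ0] with j h1 h4
  have h2 := hk2 (k, j) rfl
  have m1 : Measurable fun ω => ‖g j (Z j ω) - h (Z j ω)‖ₑ :=
    (((hg j).comp (hZ j)).sub (hh.comp (hZ j))).enorm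
  have m2 : Measurable fun ω => ‖φ k (Z j ω) - h (Z j ω)‖ₑ :=
    (((hφ k).measurable.comp (hZ j)).sub (hh.comp (hZ j))).enorm
  have m4 : Measurable fun ω => ‖φ k (Z j ω) - φ k (V ω)‖ₑ :=
    (((hφ k).measurable.comp (hZ j)).sub ((hφ k).measurable.comp hV)).enorm
  have m12 : Measurable fun ω => ‖g j (Z j ω) - h (Z j ω)‖ₑ + ‖φ k (Z j ω) - h (Z j ω)‖ₑ :=
    m1.add m2
  have m124 : Measurable fun ω => ‖g j (Z j ω) - h (Z j ω)‖ₑ + ‖φ k (Z j ω) - h (Z j ω)‖ₑ +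
      ‖φ k (Z j ω) - φ k (V ω)‖ₑ := m12.add m4
  calc ∫⁻ ω, ‖g j (Z j ω) - h (V ω)‖ₑ ∂P
      ≤ ∫⁻ ω, (‖g j (Z j ω) - h (Z j ω)‖ₑ + ‖φ k (Z j ω) - h (Z j ω)‖ₑ +
          ‖φ k (Z j ω) - φ k (V ω)‖ₑ + ‖φ k (V ω) - h (V ω)‖ₑ) ∂P := by
        refine lintegral_mono fun ω => ?_
        rw [← enorm_neg (φ k (Z j ω) - h (Z j ω))]
        have e : g j (Z j ω) - h (V ω) = (g j (Z j ω) - h (Z j ω)) + -(φ k (Z j ω) - h (Z j ω)) +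
          (φ k (Z j ω) - φ k (V ω)) + (φ k (V ω) - h (V ω)) := by ring
        rw [e]
        refine (enorm_add_le _ _).trans ?_
        gcongr
        refine (enorm_add_le _ _).trans ?_
        gcongr
        exact enorm_add_le _ _
    _ = _ := by
        rw [lintegral_add_left m124, lintegral_add_left m12, lintegral_add_left m1]
    _ ≤ δ + δ + δ + δ := by gcongr
    _ = ε := by
        rw [hδ, show ε / 4 + ε / 4 + ε / 4 + ε / 4 = 4 * (ε / 4) by ring]
        exact ENNReal.mul_div_cancel (by simp) (by simp)

end Dominated

lemma measurable_withMax_of_measurable {X : ℝ → Ω → ℝ} (hc : ∀ ω, Continuous fun t => X t ω)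
    (hX : ∀ t, Measurable (X t)) (t : ℝ) : Measurable (withMax X t) := by
  rcases le_total 0 t with ht | ht
  · exact measurable_withMax (𝒢 := fun _ => m) (fun _ _ _ => le_rfl) hc hX ht
  · have h := measurable_withMax (𝒢 := fun _ => m) (X := fun s => X (-s)) (fun _ _ _ => le_rfl)
      (fun ω => (hc ω).comp continuous_neg) (fun s => hX _) (neg_nonneg.2 ht)
    refine (hX t).prodMk ?_
    convert h.snd using 2 with ω
    simp [withMax, runMax]

lemma continuous_withMax {X : ℝ → Ω → ℝ} (hc : ∀ ω, Continuous fun t => X t ω) (ω : Ω) :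
    Continuous fun t => withMax X t ω :=
  (hc ω).prodMk (continuous_runMax (hc ω))

lemma measurable_uncurry_withMax {X : ℝ → Ω → ℝ} (hc : ∀ ω, Continuous fun t => X t ω)
    (hX : ∀ t, Measurable (X t)) : Measurable fun p : ℝ × Ω => withMax X p.1 p.2 :=
  measurable_uncurry_of_continuous_of_measurable (continuous_withMax hc)
    (measurable_withMax_of_measurable hc hX)

lemma intervalIntegrable_of_abs_le {φ : ℝ → ℝ} (hφ : Measurable φ) {C : ℝ} (hC : ∀ s, |φ s| ≤ C)
    (a b : ℝ) : IntervalIntegrable φ volume a b :=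
  IntervalIntegrable.mono_fun' (g := fun _ => C) intervalIntegrable_const
    hφ.aestronglyMeasurable (ae_of_all _ hC)

variable [IsProbabilityMeasure P] {ℱ : Filtration ℝ m} {W : ℝ → Ω → ℝ}

/-- Stability of the equation under pointwise convergence of the solutions, when the coefficients
converge almost everywhere for the law of the driving path and its running maximum. -/
theorem isSol_of_tendsto (hW : IsStandardBrownianMotion P ℱ W) (x : ℝ) {C : ℝ≥0}
    {u : ℕ → ℝ → Ω → ℝ} {v : ℝ → Ω → ℝ} (hu : ∀ j, IsDrift C ℱ (u j)) (hv : IsDrift C ℱ v)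
    (hlim : ∀ t ω, Tendsto (fun j => u j t ω) atTop (𝓝 (v t ω)))
    {g φ : ℕ → ℝ × ℝ → ℝ} {h : ℝ × ℝ → ℝ} (hg : ∀ j, Measurable (g j)) (hh : Measurable h)
    (hφ : ∀ k, Continuous (φ k)) (hgC : ∀ j p, |g j p| ≤ C) (hhC : ∀ p, |h p| ≤ C)
    (hφC : ∀ k p, |φ k p| ≤ C)
    (hgh : ∀ᵐ s ∂(volume.restrict (Ioi 0)), ∀ᵐ ω ∂P,
      Tendsto (fun j => g j (withMax (fun s ω => x + W s ω) s ω)) atTop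
        (𝓝 (h (withMax (fun s ω => x + W s ω) s ω))))
    (hφh : ∀ᵐ s ∂(volume.restrict (Ioi 0)), ∀ᵐ ω ∂P,
      Tendsto (fun k => φ k (withMax (fun s ω => x + W s ω) s ω)) atTop
        (𝓝 (h (withMax (fun s ω => x + W s ω) s ω))))
    (hsol : ∀ᵐ ω ∂P, ∀ j, IsSol (g j) (fun s => x + W s ω) (fun t => u j t ω)) :
    ∀ᵐ ω ∂P, IsSol h (fun s => x + W s ω) (fun t => v t ω) := by
  have hWc := hW.1
  have hWm : ∀ s, Measurable (W s) := fun s => (hW.2.2.1 s).mono (ℱ.le s) le_rfl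
  have hXc : ∀ {w : ℝ → Ω → ℝ}, IsDrift C ℱ w → ∀ ω, Continuous fun s => x + W s ω + w s ω :=
    fun hw ω => (continuous_const.add (hWc ω)).add (hw.lip ω).continuous
  have hXm : ∀ {w : ℝ → Ω → ℝ}, IsDrift C ℱ w → ∀ s, Measurable fun ω => x + W s ω + w s ω :=
    fun hw s => ((hWm s).const_add x).add ((hw.meas s).mono (ℱ.le s) le_rfl)
  have hYc : ∀ ω, Continuous fun s => x + W s ω := fun ω => continuous_const.add (hWc ω)
  have hYm : ∀ s, Measurable fun ω => x + W s ω := fun s => (hWm s).const_add x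
  set Z : ℕ → ℝ → Ω → ℝ × ℝ := fun j => withMax fun s ω => x + W s ω + u j s ω with hZ
  set V : ℝ → Ω → ℝ × ℝ := withMax fun s ω => x + W s ω + v s ω with hV
  have hZm : ∀ j, Measurable fun p : ℝ × Ω => Z j p.1 p.2 := fun j =>
    measurable_uncurry_withMax (hXc (hu j)) (hXm (hu j))
  have hVm : Measurable fun p : ℝ × Ω => V p.1 p.2 :=
    measurable_uncurry_withMax (hXc hv) (hXm hv)
  have hZV : ∀ s ω, Tendsto (fun j => Z j s ω) atTop (𝓝 (V s ω)) := fun s ω =>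
    ((hlim s ω).const_add _).prodMk_nhds (tendsto_runMax_of_lipschitz (hYc ω)
      (fun j => (hu j).lip ω) (hv.lip ω) (fun t => hlim t ω) s)
  set D : ℕ → ℝ × Ω → ℝ≥0∞ := fun j p => ‖g j (Z j p.1 p.2) - h (V p.1 p.2)‖ₑ with hD
  have hDm : ∀ j, Measurable (D j) := fun j =>
    (((hg j).comp (hZm j)).sub (hh.comp hVm)).enorm
  have hD0 : ∀ᵐ s ∂(volume.restrict (Ioi (0 : ℝ))),
      Tendsto (fun j => ∫⁻ ω, D j (s, ω) ∂P) atTop (𝓝 0) := by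
    filter_upwards [hgh, hφh, ae_restrict_mem measurableSet_Ioi] with s h1 h2 hs
    exact tendsto_lintegral_enorm_sub (fun j => (hZm j).comp measurable_prodMk_left)
      (hVm.comp measurable_prodMk_left) (measurable_withMax_of_measurable hYc hYm s)
      ENNReal.ofReal_ne_top (fun j A hA => sq_measure_withMax_le hW x (hu j) hs hA)
      (fun A hA => sq_measure_withMax_le hW x hv hs hA) (hZV s) hg hh hφ hgC hhC hφC h1 h2
  have key : ∀ t : ℝ, 0 ≤ t → ∀ᵐ ω ∂P, v t ω = ∫ s in (0 : ℝ)..t, h (V s ω) := by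
    intro t ht
    have hint : Tendsto (fun j => ∫⁻ ω, (∫⁻ s in Ioc 0 t, D j (s, ω)) ∂P) atTop (𝓝 0) := by
      have h1 := tendsto_lintegral_of_dominated_convergence (μ := volume.restrict (Ioc 0 t))
        (F := fun j s => ∫⁻ ω, D j (s, ω) ∂P) (f := fun _ => 0) (fun _ => C + C)
        (fun j => (hDm j).lintegral_prod_right')
        (fun j => ae_of_all _ fun s => by
          calc ∫⁻ ω, D j (s, ω) ∂P ≤ ∫⁻ _, (C + C : ℝ≥0∞) ∂P :=
                lintegral_mono fun ω => enorm_sub_le_of_abs_le (hgC _ _) (hhC _)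
            _ = C + C := by simp)
        (by simpa using ENNReal.mul_ne_top (by simp) (by simp))
        (ae_mono (Measure.restrict_mono Ioc_subset_Ioi_self le_rfl) hD0)
      simp only [lintegral_zero] at h1
      refine h1.congr fun j => ?_
      exact lintegral_lintegral_swap (f := fun s ω => D j (s, ω)) (hDm j).aemeasurable
    have hle : ∀ᵐ ω ∂P, ‖v t ω - ∫ s in (0 : ℝ)..t, h (V s ω)‖ₑ ≤
        liminf (fun j => ∫⁻ s in Ioc 0 t, D j (s, ω)) atTop := by
      filter_upwards [hsol] with ω hω
      have h1 : Tendsto (fun j => ‖u j t ω - ∫ s in (0 : ℝ)..t, h (V s ω)‖ₑ) atTop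
          (𝓝 ‖v t ω - ∫ s in (0 : ℝ)..t, h (V s ω)‖ₑ) := ((hlim t ω).sub_const _).enorm
      rw [← h1.liminf_eq]
      refine liminf_le_liminf (Eventually.of_forall fun j => ?_)
      have h2 : u j t ω = ∫ s in (0 : ℝ)..t, g j (Z j s ω) := by
        have := hω j t
        rwa [max_eq_left ht] at this
      rw [h2, ← intervalIntegral.integral_sub (f := fun s => g j (Z j s ω))
        (g := fun s => h (V s ω))
        (intervalIntegrable_of_abs_le ((hg j).comp ((hZm j).comp measurable_prodMk_right))
          (fun s => hgC j _) _ _)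
        (intervalIntegrable_of_abs_le (hh.comp (hVm.comp measurable_prodMk_right))
          (fun s => hhC _) _ _), intervalIntegral.integral_of_le ht]
      exact enorm_integral_le_lintegral_enorm _
    have hzero : ∫⁻ ω, liminf (fun j => ∫⁻ s in Ioc 0 t, D j (s, ω)) atTop ∂P = 0 := by
      refine le_antisymm ((lintegral_liminf_le fun j => ?_).trans hint.liminf_eq.le) zero_le
      exact (hDm j).lintegral_prod_left'
    have hm : Measurable fun ω => liminf (fun j => ∫⁻ s in Ioc 0 t, D j (s, ω)) atTop :=
      Measurable.liminf fun j => (hDm j).lintegral_prod_left'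
    filter_upwards [hle, (lintegral_eq_zero_iff hm).1 hzero] with ω h1 h2
    rw [h2] at h1
    exact sub_eq_zero.1 (enorm_eq_zero.1 (le_antisymm h1 zero_le))
  have hrat : ∀ᵐ ω ∂P, ∀ q : ℚ, 0 ≤ (q : ℝ) → v q ω = ∫ s in (0 : ℝ)..q, h (V s ω) := by
    rw [ae_all_iff]
    intro q
    by_cases hq : 0 ≤ (q : ℝ)
    · exact (key q hq).mono fun _ h _ => h
    · exact ae_of_all _ fun _ h => absurd h hq
  filter_upwards [hrat] with ω hω
  have hprim : Continuous fun t : ℝ => ∫ s in (0 : ℝ)..max t 0, h (V s ω) :=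
    (intervalIntegral.continuous_primitive (fun a b => intervalIntegrable_of_abs_le
      (hh.comp (hVm.comp measurable_prodMk_right)) (fun s => hhC _) a b) 0).comp
      (continuous_id.max continuous_const)
  refine congrFun (Rat.denseRange_cast.equalizer (hv.lip ω).continuous hprim ?_)
  ext q
  rcases le_total 0 (q : ℝ) with hq | hq
  · simp only [Function.comp_apply, max_eq_left hq]
    exact hω q hq
  · simp [max_eq_right hq, hv.zero _ hq]

end Stability

/-- **Lusin's theorem** for bounded real functions on a space carrying a regular finite measure. -/
lemma exists_isCompact_continuousOn {E : Type*} [TopologicalSpace E] [NormalSpace E] [T2Space E]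
    [MeasurableSpace E] [BorelSpace E] {μ : Measure E} [IsFiniteMeasure μ] [μ.WeaklyRegular]
    [μ.InnerRegularCompactLTTop] {f : E → ℝ} (hf : Measurable f) {C : ℝ} (hC : ∀ p, |f p| ≤ C)
    {δ : ℝ} (hδ : 0 < δ) :
    ∃ K, IsCompact K ∧ ContinuousOn f K ∧ μ Kᶜ ≤ ENNReal.ofReal δ := by
  have hLp : MemLp f 1 μ := MemLp.of_bound hf.aestronglyMeasurable C (ae_of_all _ hC)
  choose h hh hh' using fun n : ℕ =>
    hLp.exists_boundedContinuous_eLpNorm_sub_le ENNReal.one_ne_top (ε := (n : ℝ≥0∞)⁻¹) (by simp)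
  have hm : TendstoInMeasure μ (fun n => ⇑(h n)) atTop f := by
    refine tendstoInMeasure_of_tendsto_eLpNorm one_ne_zero (fun n => (hh' n).1)
      hf.aestronglyMeasurable ?_
    refine tendsto_of_tendsto_of_tendsto_of_le_of_le tendsto_const_nhds
      ENNReal.tendsto_inv_nat_nhds_zero (fun _ => zero_le) fun n => ?_
    rw [eLpNorm_sub_comm]
    exact hh n
  obtain ⟨ns, -, hns⟩ := hm.exists_seq_tendsto_ae
  obtain ⟨t, ht, hμt, hu⟩ := tendstoUniformlyOn_of_ae_tendsto'
    (fun n => (h (ns n)).continuous.measurable.stronglyMeasurable) hf.stronglyMeasurable hns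
    (half_pos hδ)
  obtain ⟨K, hKt, hK, hμK⟩ := ht.compl.exists_isCompact_sdiff_lt (measure_ne_top μ _)
    (ε := ENNReal.ofReal (δ / 2)) (by simpa using hδ)
  refine ⟨K, hK, (hu.continuousOn (Frequently.of_forall fun n =>
    (h (ns n)).continuous.continuousOn)).mono hKt, ?_⟩
  calc μ Kᶜ ≤ μ (t ∪ tᶜ \ K) := measure_mono fun p hp => by
        by_cases h : p ∈ t
        · exact Or.inl h
        · exact Or.inr ⟨h, hp⟩
    _ ≤ ENNReal.ofReal (δ / 2) + ENNReal.ofReal (δ / 2) :=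
        (measure_union_le _ _).trans (add_le_add hμt hμK.le)
    _ = ENNReal.ofReal δ := by
        rw [← ENNReal.ofReal_add (by positivity) (by positivity), add_halves]

section SupConvolution

/-- An asymmetric distance on the plane, ignoring downward displacements of the second
coordinate. -/
def asymDist (p q : ℝ × ℝ) : ℝ := |p.1 - q.1| + max (p.2 - q.2) 0

/-- Sup-convolution of `f` restricted to `K`, bounded by `C`. -/
noncomputable def supConv (C : ℝ) (f : ℝ × ℝ → ℝ) (K : Set (ℝ × ℝ)) (n : ℝ) (q : ℝ × ℝ) : ℝ :=
  sSup ((fun p => max 0 (f p + C - n * asymDist p q)) '' K) - C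

variable {C : ℝ≥0} {f : ℝ × ℝ → ℝ} {K : Set (ℝ × ℝ)} {n : ℝ}

lemma asymDist_nonneg (p q : ℝ × ℝ) : 0 ≤ asymDist p q :=
  add_nonneg (abs_nonneg _) (le_max_right _ _)

lemma supConv_bound (hf : ∀ p, |f p| ≤ C) (hn : 0 ≤ n) (p q : ℝ × ℝ) :
    max 0 (f p + C - n * asymDist p q) ≤ 2 * C := by
  have h1 := mul_nonneg hn (asymDist_nonneg p q)
  have h2 := (abs_le.1 (hf p)).2
  exact max_le (by positivity) (by linarith)

lemma bddAbove_supConv (hf : ∀ p, |f p| ≤ C) (hn : 0 ≤ n) (q : ℝ × ℝ) :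
    BddAbove ((fun p => max 0 (f p + C - n * asymDist p q)) '' K) :=
  ⟨2 * C, by rintro _ ⟨p, -, rfl⟩; exact supConv_bound hf hn p q⟩

lemma supConv_nonneg (q : ℝ × ℝ) :
    0 ≤ sSup ((fun p => max 0 (f p + C - n * asymDist p q)) '' K) :=
  Real.sSup_nonneg (by rintro _ ⟨p, -, rfl⟩; exact le_max_left _ _)

lemma supConv_le_add (hf : ∀ p, |f p| ≤ C) (hn : 0 ≤ n) {q q' : ℝ × ℝ} {e : ℝ} (he : 0 ≤ e)
    (h : ∀ p, asymDist p q' ≤ asymDist p q + e) :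
    supConv C f K n q ≤ supConv C f K n q' + n * e := by
  have hne := mul_nonneg hn he
  suffices sSup ((fun p => max 0 (f p + C - n * asymDist p q)) '' K) ≤
      sSup ((fun p => max 0 (f p + C - n * asymDist p q')) '' K) + n * e by
    unfold supConv; linarith
  refine Real.sSup_le ?_ (add_nonneg (supConv_nonneg q') hne)
  rintro _ ⟨p, hp, rfl⟩
  refine le_trans ?_ (add_le_add_left (le_csSup (bddAbove_supConv hf hn q') ⟨p, hp, rfl⟩) _)
  have h1 := mul_le_mul_of_nonneg_left (h p) hn
  refine max_le (add_nonneg (le_max_left _ _) hne) ?_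
  have := le_max_right 0 (f p + C - n * asymDist p q')
  linarith

lemma isRegularDrift_supConv (hf : ∀ p, |f p| ≤ C) (hn : 0 ≤ n) :
    IsRegularDrift C n (supConv C f K n) where
  cont := by
    refine LipschitzWith.continuous (K := Real.toNNReal (n * 2))
      (LipschitzWith.of_le_add_mul _ fun q q' => ?_)
    rw [Real.coe_toNNReal _ (by positivity), mul_assoc]
    refine supConv_le_add hf hn (by positivity) fun p => ?_
    have h1 : |q.1 - q'.1| ≤ dist q q' := le_max_left _ _
    have h2 : |q.2 - q'.2| ≤ dist q q' := le_max_right _ _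
    have h3 := abs_sub_le p.1 q.1 q'.1
    have h4 : max (p.2 - q'.2) 0 ≤ max (p.2 - q.2) 0 + |q.2 - q'.2| :=
      max_le (by linarith [le_max_left (p.2 - q.2) 0, le_abs_self (q.2 - q'.2)]) (by positivity)
    unfold asymDist
    linarith
  bdd q := by
    have h1 := supConv_nonneg (C := C) (f := f) (K := K) (n := n) q
    have h2 : sSup ((fun p => max 0 (f p + C - n * asymDist p q)) '' K) ≤ 2 * C :=
      Real.sSup_le (by rintro _ ⟨p, -, rfl⟩; exact supConv_bound hf hn p q) (by positivity)
    unfold supConv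
    exact abs_le.2 ⟨by linarith, by linarith⟩
  mono x y y' h := by
    have := supConv_le_add (K := K) hf hn (q := (x, y)) (q' := (x, y')) le_rfl fun p => by
      simp only [asymDist, add_zero]
      gcongr
    simpa using this
  slope x x' y h := by
    have := supConv_le_add (K := K) hf hn (q := (x, y)) (q' := (x', y)) (sub_nonneg.2 h) fun p => by
      have := abs_sub_le p.1 x x'
      rw [abs_sub_comm x x', abs_of_nonneg (sub_nonneg.2 h)] at this
      simp only [asymDist]
      linarith
    linarith

lemma tendsto_supConv (hf : ∀ p, |f p| ≤ C) (hmono : ∀ x y y', y ≤ y' → f (x, y) ≤ f (x, y'))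
    (hK : IsCompact K) (hfK : ContinuousOn f K) {q : ℝ × ℝ} (hq : q ∈ K) :
    Tendsto (fun n : ℕ => supConv C f K n q) atTop (𝓝 (f q)) := by
  have hlow : ∀ n : ℕ, f q ≤ supConv C f K n q := fun n => by
    have h1 := le_csSup (bddAbove_supConv (K := K) hf n.cast_nonneg q) ⟨q, hq, rfl⟩
    have h2 := (le_max_right _ _).trans h1
    simp only [asymDist, sub_self, abs_zero, max_self, add_zero, mul_zero, sub_zero] at h2
    unfold supConv
    unfold asymDist
    linarith
  rw [tendsto_order]
  refine ⟨fun a ha => Eventually.of_forall fun n => ha.trans_le (hlow n), fun a ha => ?_⟩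
  obtain ⟨b, hb, hba⟩ := exists_between ha
  have hbC : 0 ≤ b + C := by linarith [(abs_le.1 (hf q)).1]
  set S := K ∩ f ⁻¹' Ici b with hS
  have hSc : IsCompact S := hK.of_isClosed_subset
    (hfK.preimage_isClosed_of_isClosed hK.isClosed isClosed_Ici) inter_subset_left
  have hpos : ∀ p ∈ S, 0 < asymDist p q := by
    intro p hp
    refine lt_of_le_of_ne (asymDist_nonneg p q) fun h0 => ?_
    have h1 : |p.1 - q.1| = 0 := by
      have := le_max_right (p.2 - q.2) 0
      have := abs_nonneg (p.1 - q.1)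
      unfold asymDist at h0
      linarith
    have h2 : p.2 ≤ q.2 := by
      have := le_max_left (p.2 - q.2) 0
      unfold asymDist at h0
      linarith
    have h3 : p.1 = q.1 := sub_eq_zero.1 (abs_eq_zero.1 h1)
    have h4 := hmono q.1 p.2 q.2 h2
    have h5 : b ≤ f p := hp.2
    rw [← h3] at h4
    change f p ≤ f (p.1, q.2) at h4
    rw [h3] at h4
    change f p ≤ f q at h4
    linarith
  obtain ⟨δ, hδ, hδS⟩ : ∃ δ > 0, ∀ p ∈ S, δ ≤ asymDist p q := by
    rcases S.eq_empty_or_nonempty with he | hne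
    · exact ⟨1, one_pos, by simp [he]⟩
    · obtain ⟨p, hp, hmin⟩ := hSc.exists_isMinOn hne (f := fun p => asymDist p q)
        (Continuous.continuousOn (by unfold asymDist; fun_prop))
      exact ⟨_, hpos p hp, fun p' hp' => hmin hp'⟩
  obtain ⟨N, hN⟩ := exists_nat_gt (2 * C / δ)
  filter_upwards [eventually_ge_atTop N] with n hn
  refine lt_of_le_of_lt ?_ hba
  rw [supConv, sub_le_iff_le_add]
  refine Real.sSup_le ?_ hbC
  rintro _ ⟨p, hp, rfl⟩
  refine max_le hbC ?_
  have hnd : (0 : ℝ) ≤ n * asymDist p q := mul_nonneg n.cast_nonneg (asymDist_nonneg p q)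
  by_cases hpb : b ≤ f p
  · have h1 : 2 * (C : ℝ) ≤ n * asymDist p q := by
      have hnN : (N : ℝ) ≤ n := by exact_mod_cast hn
      calc 2 * (C : ℝ) ≤ n * δ := ((div_lt_iff₀ hδ).1 (hN.trans_le hnN)).le
        _ ≤ n * asymDist p q := by gcongr; exact hδS p ⟨hp, hpb⟩
    linarith [(abs_le.1 (hf p)).2]
  · linarith

end SupConvolution

/-- Bounded measurable functions that are nondecreasing in the second variable are almost everywhere
limits of regular coefficients. -/
theorem exists_tendsto_isRegularDrift (μ : Measure (ℝ × ℝ)) [IsFiniteMeasure μ] {C : ℝ≥0}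
    {f : ℝ × ℝ → ℝ} (hfm : Measurable f) (hf : ∀ p, |f p| ≤ C)
    (hmono : ∀ x y y', y ≤ y' → f (x, y) ≤ f (x, y')) :
    ∃ (g : ℕ → ℝ × ℝ → ℝ) (L : ℕ → ℝ), (∀ n, 0 ≤ L n) ∧ (∀ n, IsRegularDrift C (L n) (g n)) ∧
      ∀ᵐ p ∂μ, Tendsto (fun n => g n p) atTop (𝓝 (f p)) := by
  have hstep : ∀ k : ℕ, ∃ (g : ℝ × ℝ → ℝ) (L : ℝ), 0 ≤ L ∧ IsRegularDrift C L g ∧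
      μ {p | ((k : ℝ≥0∞) + 1)⁻¹ ≤ edist (g p) (f p)} ≤
        ENNReal.ofReal ((k : ℝ) + 1)⁻¹ + ((k : ℝ≥0∞) + 1)⁻¹ := by
    intro k
    obtain ⟨K, hK, hfK, hμK⟩ := exists_isCompact_continuousOn (μ := μ) hfm hf
      (δ := ((k : ℝ) + 1)⁻¹) (by positivity)
    have hlim : TendstoInMeasure (μ.restrict K) (fun n : ℕ => supConv C f K n) atTop f :=
      tendstoInMeasure_of_tendsto_ae
        (fun n => (isRegularDrift_supConv hf n.cast_nonneg).cont.aestronglyMeasurable)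
        ((ae_restrict_mem hK.measurableSet).mono fun q hq => tendsto_supConv hf hmono hK hfK hq)
    have hk : 0 < ((k : ℝ≥0∞) + 1)⁻¹ := by simp
    obtain ⟨n, hn⟩ := (ENNReal.tendsto_nhds_zero.1 (hlim _ hk) _ hk).exists
    refine ⟨_, n, n.cast_nonneg, isRegularDrift_supConv (K := K) hf n.cast_nonneg, ?_⟩
    rw [Measure.restrict_apply' hK.measurableSet] at hn
    refine (measure_mono (t := Kᶜ ∪ ({p | ((k : ℝ≥0∞) + 1)⁻¹ ≤ edist (supConv C f K n p) (f p)} ∩ K))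
      fun p hp => ?_).trans ((measure_union_le _ _).trans (add_le_add hμK hn))
    by_cases h : p ∈ K
    · exact Or.inr ⟨hp, h⟩
    · exact Or.inl h
  choose g L hL hg hμ using hstep
  have hinv : Tendsto (fun k : ℕ => ((k : ℝ≥0∞) + 1)⁻¹) atTop (𝓝 0) := by
    simpa [Function.comp_def] using
      ENNReal.tendsto_inv_nat_nhds_zero.comp (tendsto_add_atTop_nat 1)
  have hm : TendstoInMeasure μ g atTop f := by
    intro ε hε
    have h1 : Tendsto (fun k : ℕ => ENNReal.ofReal ((k : ℝ) + 1)⁻¹ + ((k : ℝ≥0∞) + 1)⁻¹) atTop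
        (𝓝 0) := by
      have h2 : Tendsto (fun k : ℕ => ENNReal.ofReal ((k : ℝ) + 1)⁻¹) atTop (𝓝 0) := by
        simpa using ENNReal.tendsto_ofReal (tendsto_one_div_add_atTop_nhds_zero_nat (𝕜 := ℝ))
      simpa using h2.add hinv
    refine tendsto_of_tendsto_of_tendsto_of_le_of_le' tendsto_const_nhds h1
      (Eventually.of_forall fun _ => zero_le) ?_
    filter_upwards [ENNReal.tendsto_nhds_zero.1 hinv ε hε] with k hk
    exact (measure_mono fun p hp => hk.trans hp).trans (hμ k)
  obtain ⟨ns, -, hns⟩ := hm.exists_seq_tendsto_ae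
  exact ⟨fun i => g (ns i), fun i => L (ns i), fun i => hL _, fun i => hg _, hns⟩

lemma IsRegularDrift.mono_slope {C : ℝ≥0} {L L' : ℝ} {g : ℝ × ℝ → ℝ} (hg : IsRegularDrift C L g)
    (h : L ≤ L') : IsRegularDrift C L' g :=
  ⟨hg.cont, hg.bdd, hg.mono, fun x x' y hx => by
    nlinarith [hg.slope x x' y hx, mul_nonneg (sub_nonneg.2 h) (sub_nonneg.2 hx)]⟩

lemma IsRegularDrift.min {C : ℝ≥0} {L L' : ℝ} {g g' : ℝ × ℝ → ℝ} (hg : IsRegularDrift C L g)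
    (hg' : IsRegularDrift C L' g') :
    IsRegularDrift C (max L L') fun p => min (g p) (g' p) where
  cont := hg.cont.min hg'.cont
  bdd p := by
    have h1 := abs_le.1 (hg.bdd p)
    have h2 := abs_le.1 (hg'.bdd p)
    exact abs_le.2 ⟨le_min h1.1 h2.1, (min_le_left _ _).trans h1.2⟩
  mono x y y' h := min_le_min (hg.mono x y y' h) (hg'.mono x y y' h)
  slope x x' y h := by
    simp only [← min_add_add_right]
    exact min_le_min ((hg.mono_slope (le_max_left L L')).slope x x' y h)
      ((hg'.mono_slope (le_max_right L L')).slope x x' y h)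

/-- The minimum of `a n, …, a (n + k)`. -/
def tailMin (a : ℕ → ℝ) (n : ℕ) : ℕ → ℝ
  | 0 => a n
  | k + 1 => min (tailMin a n k) (a (n + k + 1))

lemma tailMin_succ_le (a : ℕ → ℝ) (n k : ℕ) : tailMin a n (k + 1) ≤ tailMin a n k :=
  min_le_left _ _

lemma tailMin_succ_le_succ (a : ℕ → ℝ) (n k : ℕ) : tailMin a n (k + 1) ≤ tailMin a (n + 1) k := by
  induction k with
  | zero => exact min_le_right _ _
  | succ k ih =>
    refine min_le_min ih (le_of_eq ?_)
    congr 1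
    omega

lemma le_tailMin {a : ℕ → ℝ} {n : ℕ} {b : ℝ} (h : ∀ j ≥ n, b ≤ a j) (k : ℕ) :
    b ≤ tailMin a n k := by
  induction k with
  | zero => exact h n le_rfl
  | succ k ih => exact le_min ih (h _ (by omega))

lemma tailMin_le (a : ℕ → ℝ) (n k : ℕ) : tailMin a n k ≤ a n :=
  antitone_nat_of_succ_le (f := tailMin a n) (tailMin_succ_le a n) (Nat.zero_le k)

lemma tendsto_tailMin {a : ℕ → ℝ} {b : ℝ} (h : ∀ j, b ≤ a j) (n : ℕ) :
    Tendsto (tailMin a n) atTop (𝓝 (⨅ k, tailMin a n k)) :=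
  tendsto_atTop_ciInf (antitone_nat_of_succ_le (tailMin_succ_le a n))
    ⟨b, by rintro _ ⟨k, rfl⟩; exact le_tailMin (fun j _ => h j) k⟩

lemma tendsto_iInf_tailMin {a : ℕ → ℝ} {b l : ℝ} (h : ∀ j, b ≤ a j)
    (hl : Tendsto a atTop (𝓝 l)) : Tendsto (fun n => ⨅ k, tailMin a n k) atTop (𝓝 l) := by
  rw [Metric.tendsto_atTop] at hl ⊢
  intro ε hε
  obtain ⟨N, hN⟩ := hl (ε / 2) (half_pos hε)
  have hN' : ∀ j ≥ N, l - ε / 2 ≤ a j ∧ a j ≤ l + ε / 2 := fun j hj => by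
    have := abs_lt.1 (hN j hj)
    constructor <;> linarith
  refine ⟨N, fun n hn => ?_⟩
  have h1 : l - ε / 2 ≤ ⨅ k, tailMin a n k :=
    le_ciInf fun k => le_tailMin (fun j hj => (hN' j (hn.le.trans hj)).1) k
  have h2 : ⨅ k, tailMin a n k ≤ l + ε / 2 :=
    le_of_tendsto' (tendsto_tailMin h n) fun k => (tailMin_le a n k).trans (hN' n hn).2
  rw [Real.dist_eq, abs_lt]
  constructor <;> linarith

lemma exists_isRegularDrift_tailMin {C : ℝ≥0} {f : ℕ → ℝ × ℝ → ℝ} {L : ℕ → ℝ} (hL : ∀ n, 0 ≤ L n)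
    (hf : ∀ n, IsRegularDrift C (L n) (f n)) (n k : ℕ) :
    ∃ L', 0 ≤ L' ∧ IsRegularDrift C L' fun p => tailMin (fun j => f j p) n k := by
  induction k with
  | zero => exact ⟨L n, hL n, hf n⟩
  | succ k ih =>
    obtain ⟨L', hL', h⟩ := ih
    exact ⟨_, le_max_of_le_left hL', h.min (hf (n + k + 1))⟩

lemma isDrift_of_tendsto {Ω : Type*} {C : ℝ≥0} {𝒢 : ℝ → MeasurableSpace Ω} {u : ℕ → ℝ → Ω → ℝ}
    {v : ℝ → Ω → ℝ} (hu : ∀ j, IsDrift C 𝒢 (u j))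
    (h : ∀ t ω, Tendsto (fun j => u j t ω) atTop (𝓝 (v t ω))) : IsDrift C 𝒢 v where
  lip ω := LipschitzWith.of_dist_le_mul fun s t =>
    le_of_tendsto' ((h s ω).dist (h t ω)) fun j => ((hu j).lip ω).dist_le_mul s t
  zero t ht ω := tendsto_nhds_unique (h t ω) (by simp [(hu _).zero t ht ω])
  meas t := by
    let _ : MeasurableSpace Ω := 𝒢 t
    exact measurable_of_tendsto_metrizable (fun j => (hu j).meas t)
      (tendsto_pi_nhds.2 fun ω => h t ω)

section Existence

variable {Ω : Type*} {m : MeasurableSpace Ω} {P : Measure Ω}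
  {ℱ : Filtration ℝ m} {W : ℝ → Ω → ℝ}

lemma naturalSigma_mono (W : ℝ → Ω → ℝ) : Monotone (naturalSigma W) := fun _ _ h =>
  biSup_mono fun _ hr => le_trans hr h

lemma measurable_naturalSigma (W : ℝ → Ω → ℝ) (t : ℝ) : Measurable[naturalSigma W t] (W t) := by
  rw [measurable_iff_comap_le]
  exact le_iSup₂_of_le t self_mem_Iic le_rfl

lemma naturalSigma_le (hW : IsStandardBrownianMotion P ℱ W) (t : ℝ) : naturalSigma W t ≤ ℱ t :=
  iSup₂_le fun s hs => (hW.2.2.1 s).comap_le.trans (ℱ.mono hs)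

variable [IsProbabilityMeasure P]

/-- A finite measure on the plane whose null sets control the law of `x + W` and its running maximum
at almost every time. -/
lemma exists_measure_withMax (hW : IsStandardBrownianMotion P ℱ W) (x : ℝ) :
    ∃ ν : Measure (ℝ × ℝ), IsFiniteMeasure ν ∧ ∀ Q : ℝ × ℝ → Prop, (∀ᵐ p ∂ν, Q p) →
      ∀ᵐ s ∂(volume.restrict (Ioi 0)), ∀ᵐ ω ∂P, Q (withMax (fun s ω => x + W s ω) s ω) := by
  have hm := measurable_uncurry_withMax (X := fun s ω => x + W s ω)
    (fun ω => continuous_const.add (hW.1 ω))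
    (fun s => ((hW.2.2.1 s).mono (ℱ.le s) le_rfl).const_add x)
  refine ⟨((volume.restrict (Ioi (0 : ℝ))).toFinite.prod P).map
    fun p => withMax (fun s ω => x + W s ω) p.1 p.2, inferInstance, fun Q hQ => ?_⟩
  have := Measure.ae_ae_of_ae_prod (ae_of_ae_map hm.aemeasurable hQ)
  rwa [ae_toFinite] at this

/-- Existence of a solution adapted to the driving Brownian motion when the coefficient is
nondecreasing in its second variable. -/
theorem exists_isSol (hW : IsStandardBrownianMotion P ℱ W) (x : ℝ) {C : ℝ≥0} {h : ℝ × ℝ → ℝ}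
    (hh : Measurable h) (hhC : ∀ p, |h p| ≤ C)
    (hmono : ∀ x y y', y ≤ y' → h (x, y) ≤ h (x, y')) :
    ∃ u : ℝ → Ω → ℝ, IsDrift C (naturalSigma W) u ∧
      ∀ᵐ ω ∂P, IsSol h (fun s => x + W s ω) (fun t => u t ω) := by
  obtain ⟨ν, hν, hνQ⟩ := exists_measure_withMax hW x
  obtain ⟨f, L, hL, hf, hfh⟩ := exists_tendsto_isRegularDrift ν hh hhC hmono
  have hc : ∀ ω, Continuous fun s => x + W s ω := fun ω => continuous_const.add (hW.1 ω)
  have hlow : ∀ p j, -(C : ℝ) ≤ f j p := fun p j => (abs_le.1 ((hf j).bdd p)).1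
  set g : ℕ → ℕ → ℝ × ℝ → ℝ := fun n k p => tailMin (fun j => f j p) n k with hg
  choose M hM0 hM using exists_isRegularDrift_tailMin hL hf
  set G : ℕ → ℝ × ℝ → ℝ := fun n p => ⨅ k, g n k p with hG
  have hgG : ∀ n p, Tendsto (fun k => g n k p) atTop (𝓝 (G n p)) := fun n p =>
    tendsto_tailMin (hlow p) n
  have hGm : ∀ n, Measurable (G n) := fun n =>
    measurable_of_tendsto_metrizable (fun k => (hM n k).cont.measurable)
      (tendsto_pi_nhds.2 (hgG n))
  have hGC : ∀ n p, |G n p| ≤ C := fun n p =>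
    le_of_tendsto' (hgG n p).abs fun k => (hM n k).bdd p
  set U : ℕ → ℕ → ℝ → Ω → ℝ := fun n k t ω => picardLimit C (g n k) (M n k) (fun s => x + W s ω) t
    with hU
  have hUsol : ∀ n k ω, IsSol (g n k) (fun s => x + W s ω) (fun t => U n k t ω) := fun n k ω =>
    isSol_picardLimit (hM n k) (hc ω) (hM0 n k)
  have hUd : ∀ n k, IsDrift C (naturalSigma W) (U n k) := fun n k =>
    isDrift_picardLimit (naturalSigma_mono W) (hM0 n k) (hM n k) hc
      (fun t => (measurable_naturalSigma W t).const_add x)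
  have hUle : ∀ n k n' k', (∀ p, g n k p ≤ g n' k' p) → ∀ t ω, U n k t ω ≤ U n' k' t ω :=
    fun n k n' k' hle t ω => picardLimit_le (hM n k) (hc ω) (hM n' k').cont hle
      ((hUd n' k').lip ω) (hUsol n' k' ω) t
  set v : ℕ → ℝ → Ω → ℝ := fun n t ω => ⨅ k, U n k t ω with hv
  have hUv : ∀ n t ω, Tendsto (fun k => U n k t ω) atTop (𝓝 (v n t ω)) := fun n t ω =>
    tendsto_atTop_ciInf (antitone_nat_of_succ_le fun k =>
      hUle n (k + 1) n k (fun p => tailMin_succ_le _ n k) t ω)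
      ⟨-(C * |t|), by rintro _ ⟨k, rfl⟩; exact (abs_le.1 ((hUd n k).abs_le t ω)).1⟩
  have hvd : ∀ n, IsDrift C (naturalSigma W) (v n) := fun n => isDrift_of_tendsto (hUd n) (hUv n)
  have hvsol : ∀ n, ∀ᵐ ω ∂P, IsSol (G n) (fun s => x + W s ω) (fun t => v n t ω) := fun n =>
    isSol_of_tendsto hW x (fun k => (hUd n k).mono (naturalSigma_le hW))
      ((hvd n).mono (naturalSigma_le hW)) (hUv n) (fun k => (hM n k).cont.measurable) (hGm n)
      (fun k => (hM n k).cont) (fun k => (hM n k).bdd) (hGC n) (fun k => (hM n k).bdd)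
      (ae_of_all _ fun s => ae_of_all _ fun ω => hgG n _)
      (ae_of_all _ fun s => ae_of_all _ fun ω => hgG n _)
      (ae_of_all _ fun ω k => hUsol n k ω)
  have hvmono : ∀ t ω, Monotone fun n => v n t ω := fun t ω => monotone_nat_of_le_succ fun n =>
    le_of_tendsto_of_tendsto' ((hUv n t ω).comp (tendsto_add_atTop_nat 1)) (hUv (n + 1) t ω)
      fun k => hUle n (k + 1) (n + 1) k (fun p => tailMin_succ_le_succ _ n k) t ω
  have hvlim : ∀ t ω, Tendsto (fun n => v n t ω) atTop (𝓝 (⨆ n, v n t ω)) := fun t ω =>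
    tendsto_atTop_ciSup (hvmono t ω)
      ⟨C * |t|, by rintro _ ⟨n, rfl⟩; exact (abs_le.1 ((hvd n).abs_le t ω)).2⟩
  have hud : IsDrift C (naturalSigma W) fun t ω => ⨆ n, v n t ω := isDrift_of_tendsto hvd hvlim
  refine ⟨_, hud, isSol_of_tendsto hW x (fun n => (hvd n).mono (naturalSigma_le hW))
    (hud.mono (naturalSigma_le hW)) hvlim hGm hh (fun n => (hf n).cont) hGC hhC
    (fun n => (hf n).bdd) (hνQ _ (hfh.mono fun p hp => tendsto_iInf_tailMin (hlow p) hp))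
    (hνQ _ hfh) (ae_all_iff.2 hvsol)⟩

end Existence

end

/-- Strong existence for the SDE
`X_t = x + W_t + ∫_0^t b(X_s, max_{0≤u≤s} X_u) ds` with `b` bounded, measurable and, in
its second variable, strictly increasing on `{y : y ≥ x'}` for each fixed first
variable `x'`: there is a continuous process `X`, adapted to the `P`-augmented natural
filtration of `W` (each `X t` agrees a.s. with a `σ(W_s, s ≤ t)`-measurable variable),
satisfying the equation almost surely for all `t ≥ 0`. -/
theorem strong_existence_sde_max_drift
    {Ω : Type*} {m : MeasurableSpace Ω} (P : Measure Ω) [IsProbabilityMeasure P]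
    (ℱ : Filtration ℝ m) (W : ℝ → Ω → ℝ)
    (hW : IsStandardBrownianMotion P ℱ W)
    (x : ℝ) (b : ℝ → ℝ → ℝ)
    (hb_meas : Measurable (Function.uncurry b))
    (hb_bdd : ∃ C : ℝ, ∀ p q : ℝ, |b p q| ≤ C)
    (hb_mono : ∀ x' : ℝ, StrictMonoOn (b x') (Set.Ici x')) :
    ∃ X : ℝ → Ω → ℝ,
      (∀ ω, Continuous fun t => X t ω) ∧
      (∀ t : ℝ, 0 ≤ t → ∃ Y : Ω → ℝ,
        Measurable[naturalSigma W t] Y ∧ X t =ᵐ[P] Y) ∧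
      (∀ᵐ ω ∂P, ∀ t : ℝ, 0 ≤ t →
        X t ω = x + W t ω +
          ∫ s in (0:ℝ)..t,
            b (X s ω) (sSup ((fun u => X u ω) '' Set.Icc 0 s))) := by
  obtain ⟨C, hC⟩ := hb_bdd
  obtain ⟨u, hu, hsol⟩ := exists_isSol hW x (C := C.toNNReal)
    (h := fun p => b p.1 (max p.1 p.2))
    (hb_meas.comp (measurable_fst.prodMk (measurable_fst.max measurable_snd)))
    (fun p => (hC _ _).trans (Real.le_coe_toNNReal C))
    (fun x' y y' h => (hb_mono x').monotoneOn (mem_Ici.2 (le_max_left _ _))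
      (mem_Ici.2 (le_max_left _ _)) (max_le_max le_rfl h))
  have hXc : ∀ ω, Continuous fun t => x + W t ω + u t ω := fun ω =>
    (continuous_const.add (hW.1 ω)).add (hu.lip ω).continuous
  refine ⟨fun t ω => x + W t ω + u t ω, hXc, fun t _ => ⟨_, ?_, Filter.EventuallyEq.rfl⟩, ?_⟩
  · exact ((measurable_naturalSigma W t).const_add x).add (hu.meas t)
  · filter_upwards [hsol] with ω hω t ht
    have h1 := hω t
    rw [max_eq_left ht] at h1
    rw [add_right_inj]
    refine h1.trans (intervalIntegral.integral_congr fun s hs => ?_)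
    rw [uIcc_of_le ht] at hs
    have h2 := self_le_runMax (hXc ω) s
    simp only [driftAlong]
    rw [max_eq_right h2, runMax_eq hs.1]
end
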